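/- arXiv:1905.10473 — 3 statements merged into one kernel-verified Lean document; each statement's English description precedes it below -/
import Mathlib

section
/- Let (A,X) be a C*-correspondence such that the left action of J_X on X is degenerate, i.e. the closed linear span of {a·x : a ∈ J_X, x ∈ X} is a proper subset of X. Then there exist a Hilbert space H, a covariant Toeplitz pair (π⁰,π¹): (A,X) → B(H) with π⁰ injective, and an element x ∈ X such that P·π¹(x) ≠ π¹(x), where P ∈ B(H) is the strong-operator limit of the net (π⁰(b))_{b ∈ N} along a positive contractive approximate unit N of J_X. -/
/-!
Common framework: Hilbert C*-modules, C*-correspondences, compact operators,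
the Katsura ideal, Toeplitz pairs, covariance, Cuntz-Pimsner algebras,
completely positive completely contractive maps, and hyperrigidity.
-/

noncomputable section

open Filter Topology Set
open scoped ComplexOrder InnerProductSpace

universe u v w u'

/-- A right Hilbert C*-module `X` over a (possibly non-unital) C*-algebra `A`.
`smulR x a` is the right action `x·a`, and `inner x y` is the `A`-valued inner
product `⟨x,y⟩`, conjugate-linear in the first variable.  The Cauchy-Schwarz
inequality `norm_inner_le` and `norm_smulR_le` are consequences of the other
axioms which we record as fields for convenience. -/
structure HilbertModule (A : Type u) (X : Type v) [NonUnitalCStarAlgebra A]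
    [NormedAddCommGroup X] [NormedSpace ℂ X] [CompleteSpace X] : Type (max u v) where
  smulR : X → A → X
  inner : X → X → A
  smulR_add_left : ∀ x y a, smulR (x + y) a = smulR x a + smulR y a
  smulR_add_right : ∀ x a b, smulR x (a + b) = smulR x a + smulR x b
  smulR_csmul_left : ∀ (z : ℂ) x a, smulR (z • x) a = z • smulR x a
  smulR_csmul_right : ∀ (z : ℂ) x a, smulR x (z • a) = z • smulR x a
  smulR_mul : ∀ x a b, smulR (smulR x a) b = smulR x (a * b)
  inner_add_right : ∀ x y z, inner x (y + z) = inner x y + inner x z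
  inner_csmul_right : ∀ (z : ℂ) x y, inner x (z • y) = z • inner x y
  star_inner : ∀ x y, star (inner x y) = inner y x
  inner_smulR_right : ∀ x y a, inner x (smulR y a) = inner x y * a
  inner_self_nonneg : ∀ x, ∃ a, inner x x = star a * a
  inner_self_eq_zero : ∀ x, inner x x = 0 → x = 0
  norm_sq_eq_norm_inner_self : ∀ x, ‖x‖ ^ 2 = ‖inner x x‖
  norm_inner_le : ∀ x y, ‖inner x y‖ ≤ ‖x‖ * ‖y‖
  norm_smulR_le : ∀ x a, ‖smulR x a‖ ≤ ‖x‖ * ‖a‖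

/-- A C*-correspondence over `A`:  a right Hilbert `A`-module together with a
left action of `A` by adjointable operators, i.e. a *-homomorphism
`λ = lact : A → L(X)`. -/
structure Correspondence (A : Type u) (X : Type v) [NonUnitalCStarAlgebra A]
    [NormedAddCommGroup X] [NormedSpace ℂ X] [CompleteSpace X]
    extends HilbertModule A X where
  lact : A → X →L[ℂ] X
  lact_add : ∀ a b, lact (a + b) = lact a + lact b
  lact_csmul : ∀ (z : ℂ) a, lact (z • a) = z • lact a
  lact_mul : ∀ a b, lact (a * b) = (lact a).comp (lact b)
  lact_adjoint : ∀ a x y, inner (lact a x) y = inner x (lact (star a) y)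
  lact_smulR : ∀ a x b, lact a (smulR x b) = smulR (lact a x) b

namespace HilbertModule

variable {A : Type u} {X : Type v} [NonUnitalCStarAlgebra A]
  [NormedAddCommGroup X] [NormedSpace ℂ X] [CompleteSpace X]

/-- The rank-one operator `θ_{x,y} : z ↦ x·⟨y,z⟩` on a Hilbert module. -/
def rankOne (M : HilbertModule A X) (x y : X) : X →L[ℂ] X :=
  LinearMap.mkContinuous
    { toFun := fun z => M.smulR x (M.inner y z)
      map_add' := fun z w => by
        show M.smulR x (M.inner y (z + w)) = M.smulR x (M.inner y z) + M.smulR x (M.inner y w)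
        rw [M.inner_add_right, M.smulR_add_right]
      map_smul' := fun c z => by
        show M.smulR x (M.inner y (c • z)) = c • M.smulR x (M.inner y z)
        rw [M.inner_csmul_right, M.smulR_csmul_right] }
    (‖x‖ * ‖y‖)
    (fun z => by
      calc ‖M.smulR x (M.inner y z)‖ ≤ ‖x‖ * ‖M.inner y z‖ := M.norm_smulR_le _ _
        _ ≤ ‖x‖ * (‖y‖ * ‖z‖) :=
            mul_le_mul_of_nonneg_left (M.norm_inner_le y z) (norm_nonneg x)
        _ = ‖x‖ * ‖y‖ * ‖z‖ := (mul_assoc _ _ _).symm)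

/-- `K(X)`, the compact operators on the Hilbert module `X`: the closed linear
span of the rank-one operators, viewed as a (closed) subspace of the bounded
operators on `X`. -/
def compacts (M : HilbertModule A X) : Submodule ℂ (X →L[ℂ] X) :=
  (Submodule.span ℂ (Set.range fun p : X × X => M.rankOne p.1 p.2)).topologicalClosure

theorem rankOne_mem_compacts (M : HilbertModule A X) (x y : X) :
    M.rankOne x y ∈ M.compacts :=
  Submodule.le_topologicalClosure _ (Submodule.subset_span ⟨(x, y), rfl⟩)

end HilbertModule

namespace Correspondence

variable {A : Type u} {X : Type v} [NonUnitalCStarAlgebra A]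
  [NormedAddCommGroup X] [NormedSpace ℂ X] [CompleteSpace X]

/-- The Katsura ideal `J_X` of a C*-correspondence: the set of `a ∈ A` such
that `λ(a)` is a compact operator on `X` and `a·b = 0` for every `b` in the
kernel of the left action `λ`. -/
def katsura (c : Correspondence A X) : Set A :=
  {a | c.lact a ∈ c.toHilbertModule.compacts ∧ ∀ b, c.lact b = 0 → a * b = 0}

/-- The left action of the Katsura ideal on `X` is non-degenerate: the closed
linear span of `{a·x : a ∈ J_X, x ∈ X}` is all of `X`. -/
def KatsuraNondegenerate (c : Correspondence A X) : Prop :=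
  (Submodule.span ℂ {z : X | ∃ a ∈ c.katsura, ∃ x : X, z = c.lact a x}).topologicalClosure = ⊤

end Correspondence

/-- A Toeplitz pair `(π⁰, π¹)` from the C*-correspondence `(A, X)` to a
C*-algebra `C`: a *-homomorphism `π⁰ : A → C` and a linear map `π¹ : X → C`
with `π⁰(a)π¹(x) = π¹(a·x)` and `π¹(x)*π¹(y) = π⁰(⟨x,y⟩)`. -/
structure ToeplitzPair {A : Type u} {X : Type v} [NonUnitalCStarAlgebra A]
    [NormedAddCommGroup X] [NormedSpace ℂ X] [CompleteSpace X]
    (c : Correspondence A X) (C : Type w) [NonUnitalCStarAlgebra C] : Type (max u v w) where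
  p0 : A →⋆ₙₐ[ℂ] C
  p1 : X →ₗ[ℂ] C
  p0_mul_p1 : ∀ a x, p0 a * p1 x = p1 (c.lact a x)
  star_p1_mul_p1 : ∀ x y, star (p1 x) * p1 y = p0 (c.toHilbertModule.inner x y)

namespace ToeplitzPair

variable {A : Type u} {X : Type v} [NonUnitalCStarAlgebra A]
  [NormedAddCommGroup X] [NormedSpace ℂ X] [CompleteSpace X]
  {c : Correspondence A X} {C : Type w} [NonUnitalCStarAlgebra C]

/-- A Toeplitz pair is covariant if `π⁰(a) = φ_π(λ(a))` for all `a ∈ J_X`,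
where `φ_π : K(X) → C` is the (unique, automatically *-homomorphic) continuous
linear map with `φ_π(θ_{x,y}) = π¹(x)π¹(y)*`. -/
def IsCovariant (T : ToeplitzPair c C) : Prop :=
  ∃ Φ : (c.toHilbertModule.compacts : Submodule ℂ (X →L[ℂ] X)) →L[ℂ] C,
    (∀ x y : X, Φ ⟨c.toHilbertModule.rankOne x y,
        c.toHilbertModule.rankOne_mem_compacts x y⟩ = T.p1 x * star (T.p1 y)) ∧
    ∀ a, (ha : a ∈ c.katsura) → T.p0 a = Φ ⟨c.lact a, ha.1⟩

end ToeplitzPair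

/-- `O` together with the covariant Toeplitz pair `ι = (ι⁰, ι¹)` is (a copy of)
the Cuntz-Pimsner algebra of the C*-correspondence `(A, X)`: `ι⁰` is injective,
`O` is generated as a C*-algebra by `ι⁰(A) ∪ ι¹(X)`, and every covariant
Toeplitz pair factors through `O`. -/
structure IsCuntzPimsner {A : Type u} {X : Type v} [NonUnitalCStarAlgebra A]
    [NormedAddCommGroup X] [NormedSpace ℂ X] [CompleteSpace X]
    (c : Correspondence A X) (O : Type w) [NonUnitalCStarAlgebra O]
    (ι : ToeplitzPair c O) : Prop where
  covariant : ι.IsCovariant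
  injective : Function.Injective ι.p0
  generates :
    closure ((NonUnitalStarAlgebra.adjoin ℂ (Set.range ι.p0 ∪ Set.range ι.p1) :
      NonUnitalStarSubalgebra ℂ O) : Set O) = Set.univ
  universal : ∀ (C : Type u') [NonUnitalCStarAlgebra C] (T : ToeplitzPair c C),
    T.IsCovariant → ∃ ρ : O →⋆ₙₐ[ℂ] C, (∀ a, ρ (ι.p0 a) = T.p0 a) ∧ ∀ x, ρ (ι.p1 x) = T.p1 x

/-- The operator space `S(A,X)`: the closed linear span of
`ι⁰(A) ∪ ι¹(X) ∪ ι¹(X)*` inside the Cuntz-Pimsner algebra. -/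
def SAX {A : Type u} {X : Type v} [NonUnitalCStarAlgebra A]
    [NormedAddCommGroup X] [NormedSpace ℂ X] [CompleteSpace X]
    {c : Correspondence A X} {O : Type w} [NonUnitalCStarAlgebra O]
    (ι : ToeplitzPair c O) : Set O :=
  closure ((Submodule.span ℂ (Set.range ι.p0 ∪ Set.range ι.p1 ∪ star '' Set.range ι.p1) :
    Submodule ℂ O) : Set O)

/-- `φ : C → B(H)` is a completely positive and completely contractive linear
map.  Complete positivity is recorded through the standard characterization:
for all `n`, `a : Fin n → C` and `h : Fin n → H` one has
`0 ≤ ∑_{i,j} ⟪h i, φ(a i * a j)(h j)⟫` (every positive matrix over `C` is a sum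
of Gram matrices `(a_i* a_j)_{ij}`, and positivity of a matrix of operators is
tested against vectors, so this is exactly positivity of all amplifications).
For completely positive maps the completely bounded norm coincides with the
norm, so complete contractivity is recorded as contractivity. -/
structure IsCPCMap {C : Type w} [NonUnitalCStarAlgebra C] {H : Type u'}
    [NormedAddCommGroup H] [InnerProductSpace ℂ H] [CompleteSpace H]
    (φ : C → H →L[ℂ] H) : Prop where
  map_add : ∀ x y, φ (x + y) = φ x + φ y
  map_smul : ∀ (z : ℂ) x, φ (z • x) = z • φ x
  completely_positive : ∀ (n : ℕ) (a : Fin n → C) (h : Fin n → H),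
    0 ≤ ∑ i, ∑ j, ⟪h i, φ (star (a i) * a j) (h j)⟫_ℂ
  contractive : ∀ x, ‖φ x‖ ≤ ‖x‖

/-- Hyperrigidity of a C*-correspondence `(A,X)` (with Cuntz-Pimsner algebra
`O` and canonical covariant pair `ι`): for every Hilbert space `H`, every
*-homomorphism `π : O → B(H)` and every completely positive completely
contractive map `φ : O → B(H)` agreeing with `π` on `S(A,X)`, one has `φ = π`. -/
def Hyperrigid {A : Type u} {X : Type v} [NonUnitalCStarAlgebra A]
    [NormedAddCommGroup X] [NormedSpace ℂ X] [CompleteSpace X]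
    (c : Correspondence A X) (O : Type w) [NonUnitalCStarAlgebra O]
    (ι : ToeplitzPair c O) : Prop :=
  ∀ (H : Type u') [NormedAddCommGroup H] [InnerProductSpace ℂ H] [CompleteSpace H]
    (π : O →⋆ₙₐ[ℂ] (H →L[ℂ] H)) (φ : O → H →L[ℂ] H),
    IsCPCMap φ → (∀ s ∈ SAX ι, φ s = π s) → ∀ w : O, φ w = π w


/-- The C*-algebra order: `a ≼ b` iff `b - a` is positive. -/
def CStarLe {C : Type w} [NonUnitalCStarAlgebra C] (a b : C) : Prop :=
  ∃ c, b - a = star c * c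

/-- `N` is a positive contractive approximate unit for (the closed two-sided
ideal) `J`, directed by the C*-order. -/
structure IsPosApproxUnit {C : Type w} [NonUnitalCStarAlgebra C]
    (J : Set C) (N : Set C) : Prop where
  subset : N ⊆ J
  nonempty : N.Nonempty
  pos : ∀ b ∈ N, ∃ c, b = star c * c
  contractive : ∀ b ∈ N, ‖b‖ ≤ 1
  directed : ∀ b₁ ∈ N, ∀ b₂ ∈ N, ∃ b ∈ N, CStarLe b₁ b ∧ CStarLe b₂ b
  approx : ∀ a ∈ J, ∀ ε > (0 : ℝ), ∃ b₀ ∈ N, ∀ b ∈ N, CStarLe b₀ b →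
    ‖b * a - a‖ < ε ∧ ‖a * b - a‖ < ε

/-- `P` is the limit of the net `(f b)_{b ∈ N}` (over the directed set `N`,
ordered by the C*-order) in the strong operator topology on `B(H)`. -/
def IsSOTLimitAlong {C : Type w} [NonUnitalCStarAlgebra C]
    {H : Type u'} [NormedAddCommGroup H] [InnerProductSpace ℂ H] [CompleteSpace H]
    (N : Set C) (f : C → H →L[ℂ] H) (P : H →L[ℂ] H) : Prop :=
  ∀ h : H, ∀ ε > (0 : ℝ), ∃ b₀ ∈ N, ∀ b ∈ N, CStarLe b₀ b → ‖f b h - P h‖ < ε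

/-- Auxiliary predicate for Statement 8: on the Hilbert space `H` there are a
covariant Toeplitz pair `(π⁰, π¹)` of `(A, X)` with `π⁰` injective, a positive
contractive approximate unit `N` of `J_X` and an element `x ∈ X` with
`P π¹(x) ≠ π¹(x)`, where `P` is the strong-operator limit of the net
`(π⁰(b))_{b ∈ N}`. -/
def DegenerateWitness {A : Type u} {X : Type v} [NonUnitalCStarAlgebra A]
    [NormedAddCommGroup X] [NormedSpace ℂ X] [CompleteSpace X]
    (c : Correspondence A X) (H : Type (max u v)) [NormedAddCommGroup H]
    [InnerProductSpace ℂ H] [CompleteSpace H] : Prop :=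
  ∃ T : ToeplitzPair c (H →L[ℂ] H), T.IsCovariant ∧ Function.Injective T.p0 ∧
    ∃ (N : Set A) (P : H →L[ℂ] H) (x : X),
      IsPosApproxUnit c.katsura N ∧
      IsSOTLimitAlong N (fun b => T.p0 b) P ∧
      P * T.p1 x ≠ T.p1 x

theorem exists_star_mul_self_eq {A : Type u} [NonUnitalCStarAlgebra A] (a : A) :
    ∃ d : A, star d = d ∧ star a * a = (2 * ‖a‖ : ℝ) • d - d * d := by
  let := CStarAlgebra.spectralOrder A
  let := CStarAlgebra.spectralOrderedRing A
  set s : ℝ := ‖a‖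
  set f : ℝ → ℝ := fun t => s - √(s ^ 2 - t)
  have hf : Continuous f := by fun_prop
  have hs : 0 ≤ s := norm_nonneg a
  have hf0 : f 0 = 0 := by simp [f, Real.sqrt_sq hs]
  have hx : IsSelfAdjoint (star a * a) := .star_mul_self a
  refine ⟨cfcₙ f (star a * a), (cfcₙ_predicate f (star a * a)), ?_⟩
  have key : cfcₙ (fun t => (2 * s) • f t - f t * f t) (star a * a) = star a * a := by
    conv_rhs => rw [← cfcₙ_id ℝ (star a * a)]
    refine cfcₙ_congr fun t ht => ?_
    have ht1 : t ≤ s ^ 2 := by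
      have h1 := NonUnitalIsometricContinuousFunctionalCalculus.norm_quasispectrum_le (star a * a)
        ht hx
      rw [CStarRing.norm_star_mul_self] at h1
      have := (le_abs_self t).trans h1
      nlinarith
    have := Real.sq_sqrt (sub_nonneg.2 ht1)
    simp only [f, smul_eq_mul, id]
    nlinarith
  have e1 := cfcₙ_sub (R := ℝ) (fun t => (2 * s) • f t) (fun t => f t * f t) (star a * a)
    (by fun_prop) (by simp [hf0]) (by fun_prop) (by simp [hf0])
  have e2 := cfcₙ_smul (R := ℝ) (2 * s) f (star a * a) (by fun_prop) hf0
  have e3 := cfcₙ_mul (R := ℝ) f f (star a * a) (by fun_prop) hf0 (by fun_prop) hf0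
  rw [e1, e2, e3] at key
  exact key.symm

/-- The Hilbert space obtained from a positive semidefinite sesquilinear form. -/
theorem exists_hilbert_completion (V : Type w) [AddCommGroup V] [Module ℂ V]
    (B : PreInnerProductSpace.Core ℂ V) :
    ∃ (H : Type w) (_ : NormedAddCommGroup H) (_ : InnerProductSpace ℂ H) (_ : CompleteSpace H)
      (j : V →ₗ[ℂ] H), DenseRange j ∧ ∀ v w, ⟪j v, j w⟫_ℂ = B.inner v w := by
  let : SeminormedAddCommGroup V := InnerProductSpace.Core.toSeminormedAddCommGroup (c := B)
  let : InnerProductSpace ℂ V := InnerProductSpace.ofCore B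
  refine ⟨UniformSpace.Completion V, inferInstance, inferInstance, inferInstance,
    (UniformSpace.Completion.toComplL (𝕜 := ℂ) (E := V)).toLinearMap,
    UniformSpace.Completion.denseRange_coe, fun v w => ?_⟩
  exact UniformSpace.Completion.inner_coe v w

section Representation

variable {V : Type w} {H : Type v} [AddCommGroup V] [Module ℂ V] [NormedAddCommGroup H]
  [InnerProductSpace ℂ H]

theorem ContinuousLinearMap.ext_denseRange {E : Type v} {F : Type w} {V : Type u}
    [NormedAddCommGroup E] [NormedSpace ℂ E] [NormedAddCommGroup F] [NormedSpace ℂ F] {j : V → E}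
    (hj : DenseRange j) {S T : E →L[ℂ] F} (h : ∀ v, S (j v) = T (j v)) : S = T :=
  ContinuousLinearMap.ext fun x => congrFun (hj.equalizer S.continuous T.continuous (funext h)) x

theorem norm_le_of_formal_star {A : Type u} [NonUnitalCStarAlgebra A] (j : V →ₗ[ℂ] H)
    (α : A → V →ₗ[ℂ] V)
    (hsub : ∀ a b v, j (α (a - b) v) = j (α a v) - j (α b v))
    (hsmul : ∀ (z : ℂ) a v, j (α (z • a) v) = z • j (α a v))
    (hmul : ∀ a b v, j (α (a * b) v) = j (α a (α b v)))
    (hstar : ∀ a v w, ⟪j (α a v), j w⟫_ℂ = ⟪j v, j (α (star a) w)⟫_ℂ) (a : A) (v : V) :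
    ‖j (α a v)‖ ≤ ‖a‖ * ‖j v‖ := by
  obtain ⟨d, hd, hda⟩ := exists_star_mul_self_eq a
  have h3 : ∀ x : H, ⟪x, x⟫_ℂ = (‖x‖ : ℂ) ^ 2 := fun x => inner_self_eq_norm_sq_to_K x
  have h1 : (‖j (α a v)‖ : ℂ) ^ 2 = ((2 * ‖a‖ : ℝ) : ℂ) * ⟪j v, j (α d v)⟫_ℂ
      - ⟪j (α d v), j (α d v)⟫_ℂ := by
    have h2 : (2 * ‖a‖ : ℝ) • d = ((2 * ‖a‖ : ℝ) : ℂ) • d := (Complex.coe_smul _ _).symm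
    rw [← h3, hstar, ← hmul, hda, h2, hsub, hsmul, inner_sub_right, inner_smul_right, hmul,
      hstar, hd]
  have h4 : (‖(‖a‖ : ℂ) • j v - j (α d v)‖ : ℂ) ^ 2 = (‖a‖ : ℂ) ^ 2 * (‖j v‖ : ℂ) ^ 2 -
      (‖j (α a v)‖ : ℂ) ^ 2 := by
    rw [← h3, h1, inner_sub_left, inner_sub_right, inner_sub_right, inner_smul_left,
      inner_smul_left, inner_smul_right, inner_smul_right, hstar d v v, hd, h3 (j v)]
    simp
    ring
  have h5 : ‖(‖a‖ : ℂ) • j v - j (α d v)‖ ^ 2 = ‖a‖ ^ 2 * ‖j v‖ ^ 2 - ‖j (α a v)‖ ^ 2 := by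
    exact_mod_cast h4
  refine le_of_sq_le_sq ?_ (by positivity)
  nlinarith [sq_nonneg (‖(‖a‖ : ℂ) • j v - j (α d v)‖)]

variable [CompleteSpace H]

theorem exists_rep {A : Type u} [NonUnitalCStarAlgebra A] (j : V →ₗ[ℂ] H) (hj : DenseRange j)
    (α : A → V →ₗ[ℂ] V)
    (hadd : ∀ a b v, j (α (a + b) v) = j (α a v) + j (α b v))
    (hsmul : ∀ (z : ℂ) a v, j (α (z • a) v) = z • j (α a v))
    (hmul : ∀ a b v, j (α (a * b) v) = j (α a (α b v)))
    (hstar : ∀ a v w, ⟪j (α a v), j w⟫_ℂ = ⟪j v, j (α (star a) w)⟫_ℂ) :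
    ∃ σ : A →⋆ₙₐ[ℂ] (H →L[ℂ] H), ∀ a v, σ a (j v) = j (α a v) := by
  have hsub : ∀ a b v, j (α (a - b) v) = j (α a v) - j (α b v) := fun a b v => by
    have := hadd (a - b) b v
    rw [sub_add_cancel] at this
    rw [this, add_sub_cancel_right]
  have hn := norm_le_of_formal_star j α hsub hsmul hmul hstar
  let τ : A → H →L[ℂ] H := fun a => (j ∘ₗ α a).extendOfNorm j
  have hτ : ∀ a v, τ a (j v) = j (α a v) := fun a v =>
    LinearMap.extendOfNorm_eq hj ⟨‖a‖, hn a⟩ v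
  refine ⟨{ toFun := τ, map_smul' := ?_, map_zero' := ?_, map_add' := ?_, map_mul' := ?_,
            map_star' := ?_ }, hτ⟩
  · intro z a
    refine ContinuousLinearMap.ext_denseRange hj fun v => ?_
    simp [hτ, hsmul]
  · refine ContinuousLinearMap.ext_denseRange hj fun v => ?_
    simpa [hτ] using hsmul 0 0 v
  · intro a b
    refine ContinuousLinearMap.ext_denseRange hj fun v => ?_
    simp [hτ, hadd]
  · intro a b
    refine ContinuousLinearMap.ext_denseRange hj fun v => ?_
    simp [hτ, hmul]
  · intro a
    rw [ContinuousLinearMap.star_eq_adjoint, ContinuousLinearMap.eq_adjoint_iff]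
    intro x y
    refine hj.induction_on₂ (p := fun x y => ⟪τ (star a) x, y⟫_ℂ = ⟪x, τ a y⟫_ℂ)
      (isClosed_eq (by fun_prop) (by fun_prop)) (fun v w => ?_) x y
    rw [hτ, hτ, hstar, star_star]

end Representation

theorem exists_positive_functional {A : Type u} [NonUnitalCStarAlgebra A] {b : A} (hb : b ≠ 0) :
    ∃ φ : A →ₗ[ℂ] ℂ, ((∀ a, φ (star a) = star (φ a)) ∧ ∀ a, 0 ≤ (φ (star a * a)).re) ∧
      φ (star b * b) ≠ 0 := by
  let := CStarAlgebra.spectralOrder A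
  let := CStarAlgebra.spectralOrderedRing A
  have hconv : Convex ℝ {a : A | 0 ≤ a} := (convex_Ici (𝕜 := ℝ) (0 : A))
  have hpos : 0 ≤ star b * b := star_mul_self_nonneg b
  have hnot : -(star b * b) ∉ {a : A | 0 ≤ a} := fun h => by
    have h1 : star b * b = 0 := le_antisymm (neg_nonneg.1 h) hpos
    exact hb ((CStarRing.star_mul_self_eq_zero_iff b).1 h1)
  obtain ⟨f, u, hu, hf⟩ := geometric_hahn_banach_point_closed hconv
    CStarAlgebra.isClosed_nonneg hnot
  have hu0 : u < 0 := by simpa using hf 0 (le_refl (0 : A))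
  have hf0 : ∀ a : A, 0 ≤ a → 0 ≤ f a := fun a ha => by
    by_contra! h
    have h1 := hf ((u / f a) • a) (smul_nonneg (div_nonneg_of_nonpos hu0.le h.le) ha)
    rw [map_smul, smul_eq_mul, div_mul_cancel₀ _ h.ne] at h1
    exact lt_irrefl _ h1
  let g : A →ₗ[ℝ] ℝ := f.toLinearMap + f.toLinearMap ∘ₗ (starLinearEquiv ℝ (A := A)).toLinearMap
  have hg : ∀ a, g a = f a + f (star a) := fun a => rfl
  have hgs : ∀ a, g (star a) = g a := fun a => by rw [hg, hg, star_star, add_comm]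
  let φ : A →ₗ[ℂ] ℂ := Module.Dual.extendRCLike g
  have hφ : ∀ a, φ a = g a - Complex.I * g (Complex.I • a) := fun a =>
    Module.Dual.extendRCLike_apply g a
  have hre : ∀ a, (φ a).re = g a := fun a => by simp [hφ]
  refine ⟨φ, ⟨fun a => ?_, fun a => ?_⟩, fun h => ?_⟩
  · have h1 : Complex.I • star a = star (-(Complex.I • a)) := by simp
    rw [hφ, hφ, hgs, h1, hgs, map_neg]
    simp
  · rw [hre, hg, star_mul, star_star]
    have := hf0 _ (star_mul_self_nonneg a)
    linarith
  · have h1 := hre (star b * b)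
    rw [h, hg, star_mul, star_star] at h1
    rw [map_neg] at hu
    simp at h1
    linarith

/-- Every C*-algebra has a faithful representation on a Hilbert space. -/
theorem exists_faithful_rep (A : Type u) [NonUnitalCStarAlgebra A] :
    ∃ (H : Type u) (_ : NormedAddCommGroup H) (_ : InnerProductSpace ℂ H) (_ : CompleteSpace H)
      (σ : A →⋆ₙₐ[ℂ] (H →L[ℂ] H)), Function.Injective σ := by
  classical
  let S := {φ : A →ₗ[ℂ] ℂ // (∀ a, φ (star a) = star (φ a)) ∧ ∀ a, 0 ≤ (φ (star a * a)).re}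
  let β : (S →₀ A) → (S →₀ A) → ℂ := fun v w => v.sum fun φ a => φ.1 (star a * w φ)
  have hβ : ∀ (v w : S →₀ A) (s : Finset S), v.support ⊆ s →
      β v w = ∑ φ ∈ s, φ.1 (star (v φ) * w φ) := fun v w s hs =>
    Finsupp.sum_of_support_subset _ hs _ (by simp)
  have hβ1 : ∀ s b, β (.single s b) (.single s b) = s.1 (star b * b) := fun s b => by simp [β]
  have hsymm : ∀ v w, star (β w v) = β v w := fun v w => by
    rw [hβ v w _ Finset.subset_union_left, hβ w v _ Finset.subset_union_right, star_sum]
    refine Finset.sum_congr rfl fun φ _ => ?_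
    rw [← φ.2.1, star_mul, star_star]
  let B : PreInnerProductSpace.Core ℂ (S →₀ A) :=
    { inner := β
      conj_inner_symm := fun v w => hsymm v w
      re_inner_nonneg := fun v => by
        change 0 ≤ Complex.re (∑ φ ∈ v.support, _)
        rw [Complex.re_sum]
        exact Finset.sum_nonneg fun φ _ => φ.2.2 (v φ)
      add_left := fun v v' w => by
        change β _ _ = β _ _ + β _ _
        rw [hβ v w _ Finset.subset_union_left, hβ v' w _ Finset.subset_union_right,
          hβ (v + v') w _ Finsupp.support_add, ← Finset.sum_add_distrib]
        simp [add_mul]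
      smul_left := fun v w z => by
        change β _ _ = _ * β _ _
        rw [hβ v w _ subset_rfl, hβ (z • v) w _ Finsupp.support_smul, Finset.mul_sum]
        simp [smul_mul_assoc] }
  obtain ⟨H, _, _, _, j, hj, hij⟩ := exists_hilbert_completion (S →₀ A) B
  let α : A → (S →₀ A) →ₗ[ℂ] (S →₀ A) := fun a =>
    Finsupp.mapRange.linearMap (LinearMap.mulLeft ℂ a)
  have hα : ∀ a v φ, α a v φ = a * v φ := fun a v φ => rfl
  obtain ⟨σ, hσ⟩ := exists_rep j hj α
    (fun a b v => by rw [← map_add]; congr 1; ext φ; simp [hα, add_mul])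
    (fun z a v => by rw [← map_smul]; congr 1; ext φ; simp [hα, smul_mul_assoc])
    (fun a b v => by congr 1; ext φ; simp [hα, mul_assoc])
    (fun a v w => by
      rw [hij, hij]
      change β _ _ = β _ _
      rw [hβ v _ _ subset_rfl, hβ (α a v) w _ (Finsupp.support_mapRange (hf := mul_zero a))]
      simp [hα, mul_assoc])
  refine ⟨H, inferInstance, inferInstance, inferInstance, σ,
    (injective_iff_map_eq_zero σ).2 fun a ha => ?_⟩
  by_contra hne
  have hb : a * star a ≠ 0 := fun h => hne ((CStarRing.mul_star_self_eq_zero_iff a).1 h)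
  obtain ⟨φ, hφ, hφb⟩ := exists_positive_functional hb
  have h1 := hσ a (Finsupp.single ⟨φ, hφ⟩ (star a))
  have h2 : α a (Finsupp.single ⟨φ, hφ⟩ (star a)) = Finsupp.single ⟨φ, hφ⟩ (a * star a) :=
    Finsupp.mapRange_single (hf := mul_zero a)
  rw [ha, h2, zero_apply] at h1
  have h3 := hij (Finsupp.single ⟨φ, hφ⟩ (a * star a)) (Finsupp.single ⟨φ, hφ⟩ (a * star a))
  rw [← h1, inner_zero_left] at h3
  apply hφb
  rw [h3]
  exact (hβ1 ⟨φ, hφ⟩ (a * star a)).symm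

/-- The bounded families in a normed space. -/
def boundedFamilies (ι : Type u) (F : Type w) [NormedAddCommGroup F] [NormedSpace ℂ F] :
    Submodule ℂ (ι → F) where
  carrier := {h | ∃ C, ∀ i, ‖h i‖ ≤ C}
  add_mem' := fun ⟨C, hC⟩ ⟨D, hD⟩ => ⟨C + D, fun i => norm_add_le_of_le (hC i) (hD i)⟩
  zero_mem' := ⟨0, fun i => by simp⟩
  smul_mem' := fun z h ⟨C, hC⟩ => ⟨‖z‖ * C, fun i => by
    rw [Pi.smul_apply, norm_smul]
    exact mul_le_mul_of_nonneg_left (hC i) (norm_nonneg z)⟩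

section Ultrapower

variable {ι : Type u} {F : Type w} [NormedAddCommGroup F] [InnerProductSpace ℂ F]

/-- The family obtained by applying an operator to every member of a bounded family. -/
def boundedFamilies.map (T : F →L[ℂ] F) :
    boundedFamilies ι F →ₗ[ℂ] boundedFamilies ι F where
  toFun h := ⟨fun i => T (h.1 i), by
    obtain ⟨C, hC⟩ := h.2
    exact ⟨‖T‖ * C, fun i => T.le_opNorm_of_le (hC i)⟩⟩
  map_add' h k := by ext i; simp
  map_smul' z h := by ext i; simp

/-- A Hilbert space of bounded families modulo an ultrafilter, on which the operators on `F`
act entrywise. -/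
structure IsUltrapower (ω : Ultrafilter ι) {G : Type v} [NormedAddCommGroup G]
    [InnerProductSpace ℂ G] [CompleteSpace G] [CompleteSpace F]
    (ρ : (F →L[ℂ] F) →⋆ₙₐ[ℂ] (G →L[ℂ] G)) (q : boundedFamilies ι F →ₗ[ℂ] G) : Prop where
  dense : DenseRange q
  tendsto_inner : ∀ h k, Tendsto (fun i => ⟪h.1 i, k.1 i⟫_ℂ) ω (𝓝 ⟪q h, q k⟫_ℂ)
  map_apply : ∀ T h, ρ T (q h) = q (boundedFamilies.map T h)

theorem exists_ultrapower [CompleteSpace F] (ω : Ultrafilter ι) :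
    ∃ (G : Type (max u w)) (_ : NormedAddCommGroup G) (_ : InnerProductSpace ℂ G)
      (_ : CompleteSpace G) (ρ : (F →L[ℂ] F) →⋆ₙₐ[ℂ] (G →L[ℂ] G))
      (q : boundedFamilies ι F →ₗ[ℂ] G), IsUltrapower ω ρ q := by
  have hlim : ∀ h k : boundedFamilies ι F, ∃ z,
      Tendsto (fun i => ⟪h.1 i, k.1 i⟫_ℂ) ω (𝓝 z) := fun h k => by
    obtain ⟨C, hC⟩ := h.2
    obtain ⟨D, hD⟩ := k.2
    have hb : (ω.map fun i => ⟪h.1 i, k.1 i⟫_ℂ : Filter ℂ) ≤ 𝓟 (Metric.closedBall 0 (C * D)) := by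
      refine le_principal_iff.2 (Filter.mem_map.2 (Filter.univ_mem' fun i => ?_))
      rw [mem_preimage, mem_closedBall_zero_iff]
      exact (norm_inner_le_norm _ _).trans
        (mul_le_mul (hC i) (hD i) (norm_nonneg _) ((norm_nonneg _).trans (hC i)))
    obtain ⟨z, -, hz⟩ := (isCompact_closedBall (0 : ℂ) (C * D)).ultrafilter_le_nhds _ hb
    exact ⟨z, hz⟩
  choose β hβ using hlim
  have huniq : ∀ {h k z}, Tendsto (fun i => ⟪h.1 i, k.1 i⟫_ℂ) ω (𝓝 z) → β h k = z :=
    fun {h k z} hz => tendsto_nhds_unique (hβ h k) hz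
  let B : PreInnerProductSpace.Core ℂ (boundedFamilies ι F) :=
    { inner := β
      conj_inner_symm := fun h k => by
        refine (huniq ?_).symm
        simpa [Function.comp_def] using (Complex.continuous_conj.tendsto _).comp (hβ k h)
      re_inner_nonneg := fun h => by
        refine ge_of_tendsto' ((Complex.continuous_re.tendsto _).comp (hβ h h)) fun i => ?_
        exact inner_self_nonneg (𝕜 := ℂ)
      add_left := fun h k l => by
        refine huniq ?_
        simpa [inner_add_left] using (hβ h l).add (hβ k l)
      smul_left := fun h k z => by
        refine huniq ?_
        simpa [inner_smul_left, mul_comm] using (hβ h k).const_mul (starRingEnd ℂ z) }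
  obtain ⟨G, _, _, _, q, hq, hqi⟩ := exists_hilbert_completion _ B
  obtain ⟨ρ, hρ⟩ := exists_rep q hq (boundedFamilies.map (ι := ι) (F := F))
    (fun S T h => by rw [← map_add]; rfl)
    (fun z T h => by rw [← map_smul]; rfl)
    (fun S T h => rfl)
    (fun T h k => by
      rw [hqi, hqi]
      change β _ _ = β _ _
      refine huniq ?_
      simpa [boundedFamilies.map, ContinuousLinearMap.star_eq_adjoint,
        ContinuousLinearMap.adjoint_inner_right] using hβ h (boundedFamilies.map (star T) k))
  exact ⟨G, inferInstance, inferInstance, inferInstance, ρ, q, hq,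
    fun h k => by rw [hqi]; exact hβ h k, hρ⟩

namespace IsUltrapower

variable {ω : Ultrafilter ι} {G : Type v} [NormedAddCommGroup G]
    [InnerProductSpace ℂ G] [CompleteSpace G] [CompleteSpace F]
    {ρ : (F →L[ℂ] F) →⋆ₙₐ[ℂ] (G →L[ℂ] G)} {q : boundedFamilies ι F →ₗ[ℂ] G}

theorem tendsto_norm (hq : IsUltrapower ω ρ q) (h : boundedFamilies ι F) :
    Tendsto (fun i => ‖h.1 i‖) ω (𝓝 ‖q h‖) := by
  have h1 := (Complex.continuous_re.tendsto _).comp (hq.tendsto_inner h h)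
  have h2 := (Real.continuous_sqrt.tendsto _).comp h1
  have e1 : ∀ x : F, ‖x‖ = √(⟪x, x⟫_ℂ).re := fun x => norm_eq_sqrt_re_inner (𝕜 := ℂ) x
  have e2 : ‖q h‖ = √(⟪q h, q h⟫_ℂ).re := norm_eq_sqrt_re_inner (𝕜 := ℂ) (q h)
  rw [e2]
  simp only [e1]
  exact h2

theorem injective (hq : IsUltrapower ω ρ q) : Function.Injective ρ := by
  refine (injective_iff_map_eq_zero ρ).2 fun T hT => ContinuousLinearMap.ext fun x => ?_
  let h : boundedFamilies ι F := ⟨fun _ => x, ‖x‖, fun _ => le_rfl⟩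
  have h1 := hq.map_apply T h
  rw [hT, zero_apply] at h1
  have h2 := hq.tendsto_norm (boundedFamilies.map T h)
  rw [← h1, norm_zero] at h2
  exact norm_eq_zero.1 (tendsto_nhds_unique tendsto_const_nhds h2)

end IsUltrapower

end Ultrapower

/-- A self-adjoint element `G` of a C*-algebra is positive if `cGc` is negative only in the trivial
case. -/
theorem IsSelfAdjoint.exists_eq_star_mul_self {B : Type u} [NonUnitalCStarAlgebra B] {G : B}
    (hG : IsSelfAdjoint G)
    (h : ∀ c d : B, star c = c → c * G * c = -(star d * d) → d = 0) :
    ∃ D : B, G = star D * D := by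
  let := CStarAlgebra.spectralOrder B
  let := CStarAlgebra.spectralOrderedRing B
  set c := G⁻
  have hc : IsSelfAdjoint c := (CFC.negPart_nonneg G).isSelfAdjoint
  have h1 : c * G * c = -(c * c * c) := by
    conv_lhs => rw [← CFC.posPart_sub_negPart G hG, mul_sub, CFC.negPart_mul_posPart]
    rw [zero_sub, neg_mul]
  have h2 : 0 ≤ c * c * c := hc.conjugate_nonneg (CFC.negPart_nonneg G)
  obtain ⟨d, hd⟩ := CStarAlgebra.nonneg_iff_eq_star_mul_self.1 h2
  have hc0 : c = 0 := by
    have h4 : c * c * c = 0 := by rw [hd, h c d hc (h1.trans (by rw [hd])), mul_zero]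
    have h5 : star (c * c) * (c * c) = 0 := by
      rw [star_mul, hc.star_eq, ← mul_assoc, h4, zero_mul]
    have h6 : star c * c = 0 := by
      rw [hc.star_eq]; exact (CStarRing.star_mul_self_eq_zero_iff _).1 h5
    exact (CStarRing.star_mul_self_eq_zero_iff _).1 h6
  refine CStarAlgebra.nonneg_iff_eq_star_mul_self.1 ?_
  rw [← CFC.posPart_sub_negPart G hG]
  change 0 ≤ G⁺ - c
  rw [hc0, sub_zero]
  exact CFC.posPart_nonneg G

namespace HilbertModule

variable {A : Type u} {X : Type v} [NonUnitalCStarAlgebra A]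
  [NormedAddCommGroup X] [NormedSpace ℂ X] [CompleteSpace X] (M : HilbertModule A X)

/-- The inner product with a fixed left entry, as a linear map. -/
def innerₗ (x : X) : X →ₗ[ℂ] A where
  toFun y := M.inner x y
  map_add' y z := M.inner_add_right x y z
  map_smul' z y := M.inner_csmul_right z x y

theorem inner_sum_right {ι : Type w} (x : X) (s : Finset ι) (y : ι → X) :
    M.inner x (∑ i ∈ s, y i) = ∑ i ∈ s, M.inner x (y i) :=
  map_sum (M.innerₗ x) y s

theorem inner_zero_right (x : X) : M.inner x 0 = 0 :=
  map_zero (M.innerₗ x)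

theorem inner_sub_right (x y z : X) : M.inner x (y - z) = M.inner x y - M.inner x z :=
  map_sub (M.innerₗ x) y z

theorem inner_zero_left (x : X) : M.inner 0 x = 0 := by
  rw [← M.star_inner, inner_zero_right, star_zero]

theorem inner_sum_left {ι : Type w} (x : X) (s : Finset ι) (y : ι → X) :
    M.inner (∑ i ∈ s, y i) x = ∑ i ∈ s, M.inner (y i) x := by
  rw [← M.star_inner, inner_sum_right, star_sum]
  exact Finset.sum_congr rfl fun i _ => M.star_inner x (y i)

theorem inner_smulR_left (x y : X) (a : A) : M.inner (M.smulR x a) y = star a * M.inner x y := by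
  rw [← M.star_inner, M.inner_smulR_right, star_mul, M.star_inner]

theorem ext_inner {y z : X} (h : ∀ x, M.inner x y = M.inner x z) : y = z := by
  rw [← sub_eq_zero]
  refine M.inner_self_eq_zero _ ?_
  rw [inner_sub_right, h, sub_self]

/-- The Gram matrix of a finite family is of the form `D* D`. -/
theorem exists_gram_factorization {ι : Type w} [Fintype ι] (x : ι → X) :
    ∃ D : CStarMatrix ι ι A, (CStarMatrix.ofMatrix fun i j => M.inner (x i) (x j)) = star D * D := by
  let := CStarAlgebra.spectralOrder A
  let := CStarAlgebra.spectralOrderedRing A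
  refine IsSelfAdjoint.exists_eq_star_mul_self ?_ fun c d hc hd => ?_
  · ext i j
    exact M.star_inner (x j) (x i)
  set G : CStarMatrix ι ι A := CStarMatrix.ofMatrix fun i j => M.inner (x i) (x j)
  have h3 : ∀ k, (c * G * c) k k =
      M.inner (∑ i, M.smulR (x i) (c i k)) (∑ i, M.smulR (x i) (c i k)) := by
    intro k
    have hck : ∀ i, c k i = star (c i k) := fun i => by
      rw [← CStarMatrix.star_apply, hc]
    rw [inner_sum_right, CStarMatrix.mul_apply]
    refine Finset.sum_congr rfl fun j _ => ?_
    rw [M.inner_smulR_right, inner_sum_left, CStarMatrix.mul_apply]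
    congr 1
    refine Finset.sum_congr rfl fun i _ => ?_
    rw [inner_smulR_left, hck]
    rfl
  ext i k
  obtain ⟨a, ha⟩ := M.inner_self_nonneg (∑ i, M.smulR (x i) (c i k))
  have h5 : ∑ i, star (d i k) * d i k ≤ 0 := by
    have h4 : ∑ i, star (d i k) * d i k = (star d * d) k k := by
      rw [CStarMatrix.mul_apply]; rfl
    rw [h4, ← neg_nonneg, ← CStarMatrix.neg_apply, ← hd, h3, ha]
    exact star_mul_self_nonneg a
  have h6 : star (d i k) * d i k ≤ 0 :=
    (Finset.single_le_sum (f := fun i => star (d i k) * d i k)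
      (fun i _ => star_mul_self_nonneg _) (Finset.mem_univ i)).trans h5
  exact (CStarRing.star_mul_self_eq_zero_iff _).1 (le_antisymm h6 (star_mul_self_nonneg _))

end HilbertModule

theorem inner_rep_left {A : Type u} [NonUnitalCStarAlgebra A] {K : Type w} [NormedAddCommGroup K]
    [InnerProductSpace ℂ K] [CompleteSpace K] (σ : A →⋆ₙₐ[ℂ] (K →L[ℂ] K)) (a : A) (h k : K) :
    ⟪σ a h, k⟫_ℂ = ⟪h, σ (star a) k⟫_ℂ := by
  rw [map_star, ContinuousLinearMap.star_eq_adjoint, ContinuousLinearMap.adjoint_inner_right]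

namespace Correspondence

variable {A : Type u} {X : Type v} [NonUnitalCStarAlgebra A]
  [NormedAddCommGroup X] [NormedSpace ℂ X] [CompleteSpace X] (c : Correspondence A X)
  {K : Type w} [NormedAddCommGroup K] [InnerProductSpace ℂ K] [CompleteSpace K]
  (σ : A →⋆ₙₐ[ℂ] (K →L[ℂ] K))

/-- The operator on `K` whose matrix coefficients are `⟪w ⊗ h, a · w' ⊗ h'⟫` in the tensor powers of
the correspondence. -/
def wordForm : List X → List X → A → K →L[ℂ] K
  | [], [], a => σ a
  | x :: w, y :: w', a => wordForm w w' (c.inner x (c.lact a y))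
  | [], _ :: _, _ => 0
  | _ :: _, [], _ => 0

/-- The operator on `K` whose matrix coefficients are `⟪w ⊗ h, w' ⊗ h'⟫` in the Fock space. -/
def wordKernel : List X → List X → K →L[ℂ] K
  | [], [] => 1
  | x :: w, y :: w' => c.wordForm σ w w' (c.inner x y)
  | [], _ :: _ => 0
  | _ :: _, [] => 0

theorem wordForm_add (w w' : List X) (a b : A) :
    c.wordForm σ w w' (a + b) = c.wordForm σ w w' a + c.wordForm σ w w' b := by
  induction w generalizing w' a b with
  | nil => cases w' <;> simp [wordForm]
  | cons x w ih =>
    cases w' with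
    | nil => simp [wordForm]
    | cons y w' =>
      simp only [wordForm, c.lact_add, add_apply]
      rw [c.inner_add_right, ih]

theorem wordForm_smul (w w' : List X) (z : ℂ) (a : A) :
    c.wordForm σ w w' (z • a) = z • c.wordForm σ w w' a := by
  induction w generalizing w' a with
  | nil => cases w' <;> simp [wordForm]
  | cons x w ih =>
    cases w' with
    | nil => simp [wordForm]
    | cons y w' =>
      simp only [wordForm, c.lact_csmul, smul_apply]
      rw [c.inner_csmul_right, ih]

theorem wordForm_sum {ι : Type u'} (w w' : List X) (s : Finset ι) (f : ι → A) :
    c.wordForm σ w w' (∑ i ∈ s, f i) = ∑ i ∈ s, c.wordForm σ w w' (f i) :=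
  map_sum (AddMonoidHom.mk' (c.wordForm σ w w') (c.wordForm_add σ w w')) f s

theorem star_wordForm (w w' : List X) (a : A) :
    star (c.wordForm σ w w' a) = c.wordForm σ w' w (star a) := by
  induction w generalizing w' a with
  | nil => cases w' <;> simp [wordForm, ← map_star]
  | cons x w ih =>
    cases w' with
    | nil => simp [wordForm]
    | cons y w' =>
      simp only [wordForm]
      rw [ih, c.star_inner, c.lact_adjoint]

theorem star_wordKernel (w w' : List X) :
    star (c.wordKernel σ w w') = c.wordKernel σ w' w := by
  cases w <;> cases w' <;> simp [wordKernel, star_wordForm, c.star_inner]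

open Classical in
theorem wordForm_nonneg (N : ℕ) {ι : Type u'} [Fintype ι] (w : ι → List X) (d : ι → A) (h : ι → K)
    (hN : ∀ i, h i ≠ 0 → (w i).length < N) :
    0 ≤ (∑ i, ∑ j, ⟪h i, c.wordForm σ (w i) (w j) (star (d i) * d j) (h j)⟫_ℂ).re := by
  induction N generalizing w d h with
  | zero =>
    have : ∀ i, h i = 0 := fun i => by_contra fun hi => absurd (hN i hi) (Nat.not_lt_zero _)
    simp [this]
  | succ N ih =>
    set n : ι → K := fun i => if w i = [] then h i else 0 with hn
    set m : ι → K := fun i => if w i = [] then 0 else h i with hm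
    set x : ι → X := fun i => c.lact (d i) ((w i).headD 0) with hx
    obtain ⟨D, hD⟩ := c.exists_gram_factorization x
    have hDx : ∀ i j, c.inner (x i) (x j) = ∑ k, star (D k i) * D k j := fun i j => by
      have := congrFun (congrFun hD i) j
      rw [CStarMatrix.mul_apply] at this
      exact this
    have key : ∀ i j, ⟪h i, c.wordForm σ (w i) (w j) (star (d i) * d j) (h j)⟫_ℂ =
        ⟪σ (d i) (n i), σ (d j) (n j)⟫_ℂ +
          ∑ k, ⟪m i, c.wordForm σ (w i).tail (w j).tail (star (D k i) * D k j) (m j)⟫_ℂ := by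
      intro i j
      rw [← inner_sum, ← sum_apply, ← wordForm_sum, ← hDx]
      rcases hi : w i with _ | ⟨y, l⟩ <;> rcases hj : w j with _ | ⟨y', l'⟩
      · simp [wordForm, hn, hm, hi, hj, inner_rep_left]
      · simp [wordForm, hn, hm, hi, hj]
      · simp [wordForm, hn, hm, hi, hj]
      · simp only [wordForm, hn, hm, hi, hj, hx, c.lact_mul]
        simp [c.lact_adjoint]
    have e : ∑ i, ∑ j, ⟪h i, c.wordForm σ (w i) (w j) (star (d i) * d j) (h j)⟫_ℂ =
        ⟪∑ i, σ (d i) (n i), ∑ i, σ (d i) (n i)⟫_ℂ + ∑ k, ∑ i, ∑ j,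
          ⟪m i, c.wordForm σ (w i).tail (w j).tail (star (D k i) * D k j) (m j)⟫_ℂ := by
      simp only [key, Finset.sum_add_distrib, sum_inner]
      congr 1
      · simp only [inner_sum]
      · exact (Finset.sum_congr rfl fun i _ => Finset.sum_comm).trans Finset.sum_comm
    rw [e, Complex.add_re, Complex.re_sum]
    refine add_nonneg (inner_self_nonneg (𝕜 := ℂ)) (Finset.sum_nonneg fun k _ => ?_)
    refine ih _ _ _ fun i hi => ?_
    have hwi : w i ≠ [] := fun h0 => hi (by simp [hm, h0])
    have h1 := hN i (by simpa [hm, hwi] using hi)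
    have h2 := List.length_pos_of_ne_nil hwi
    rw [List.length_tail]
    omega

open Classical in
theorem wordKernel_nonneg {ι : Type u'} [Fintype ι] (w : ι → List X) (h : ι → K) :
    0 ≤ (∑ i, ∑ j, ⟪h i, c.wordKernel σ (w i) (w j) (h j)⟫_ℂ).re := by
  set n : ι → K := fun i => if w i = [] then h i else 0 with hn
  set m : ι → K := fun i => if w i = [] then 0 else h i with hm
  set x : ι → X := fun i => (w i).headD 0 with hx
  obtain ⟨D, hD⟩ := c.exists_gram_factorization x
  have hDx : ∀ i j, c.inner (x i) (x j) = ∑ k, star (D k i) * D k j := fun i j => by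
    have := congrFun (congrFun hD i) j
    rw [CStarMatrix.mul_apply] at this
    exact this
  have key : ∀ i j, ⟪h i, c.wordKernel σ (w i) (w j) (h j)⟫_ℂ = ⟪n i, n j⟫_ℂ +
      ∑ k, ⟪m i, c.wordForm σ (w i).tail (w j).tail (star (D k i) * D k j) (m j)⟫_ℂ := by
    intro i j
    rw [← inner_sum, ← sum_apply, ← wordForm_sum, ← hDx]
    rcases hi : w i with _ | ⟨y, l⟩ <;> rcases hj : w j with _ | ⟨y', l'⟩ <;>
      simp [wordKernel, hn, hm, hi, hj, hx]
  have e : ∑ i, ∑ j, ⟪h i, c.wordKernel σ (w i) (w j) (h j)⟫_ℂ =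
      ⟪∑ i, n i, ∑ i, n i⟫_ℂ + ∑ k, ∑ i, ∑ j,
        ⟪m i, c.wordForm σ (w i).tail (w j).tail (star (D k i) * D k j) (m j)⟫_ℂ := by
    simp only [key, Finset.sum_add_distrib, sum_inner]
    congr 1
    · simp only [inner_sum]
    · exact (Finset.sum_congr rfl fun i _ => Finset.sum_comm).trans Finset.sum_comm
  rw [e, Complex.add_re, Complex.re_sum]
  refine add_nonneg (inner_self_nonneg (𝕜 := ℂ)) (Finset.sum_nonneg fun k _ => ?_)
  refine c.wordForm_nonneg σ (∑ i, (w i).length + 1) _ _ _ fun i _ => ?_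
  have h1 := Finset.single_le_sum (f := fun i => (w i).length) (fun _ _ => Nat.zero_le _)
    (Finset.mem_univ i)
  rw [List.length_tail]
  omega

/-- The positive semidefinite form defining the Fock space. -/
abbrev fockCore : PreInnerProductSpace.Core ℂ (List X →₀ K) :=
  have hsum : ∀ u v : List X →₀ K, ∀ s : Finset (List X), u.support ⊆ s → ∀ t : Finset (List X),
      v.support ⊆ t → (u.sum fun w h => v.sum fun w' h' => ⟪h, c.wordKernel σ w w' h'⟫_ℂ) =
        ∑ w ∈ s, ∑ w' ∈ t, ⟪u w, c.wordKernel σ w w' (v w')⟫_ℂ := fun u v s hs t ht => by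
    rw [Finsupp.sum_of_support_subset _ hs _ (by simp)]
    exact Finset.sum_congr rfl fun w _ => Finsupp.sum_of_support_subset _ ht _ (by simp)
  { inner := fun u v => u.sum fun w h => v.sum fun w' h' => ⟪h, c.wordKernel σ w w' h'⟫_ℂ
    conj_inner_symm := fun u v => by
      rw [hsum _ _ _ subset_rfl _ subset_rfl, hsum _ _ _ subset_rfl _ subset_rfl, map_sum,
        Finset.sum_comm]
      refine Finset.sum_congr rfl fun w _ => ?_
      rw [map_sum]
      refine Finset.sum_congr rfl fun w' _ => ?_
      rw [inner_conj_symm, ← c.star_wordKernel σ w, ContinuousLinearMap.star_eq_adjoint,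
        ContinuousLinearMap.adjoint_inner_right]
    re_inner_nonneg := fun v => by
      rw [hsum _ _ _ subset_rfl _ subset_rfl, ← Finset.sum_coe_sort]
      simp only [← Finset.sum_coe_sort v.support]
      exact c.wordKernel_nonneg σ (fun i : v.support => i.1) fun i => v i.1
    add_left := fun u v x => by
      classical
      rw [hsum u x _ (Finset.subset_union_left (s₂ := v.support)) _ subset_rfl,
        hsum v x _ (Finset.subset_union_right (s₁ := u.support)) _ subset_rfl,
        hsum (u + v) x _ Finsupp.support_add _ subset_rfl]
      simp [Finset.sum_add_distrib]
    smul_left := fun u x z => by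
      rw [hsum u x _ subset_rfl _ subset_rfl,
        hsum (z • u) x _ Finsupp.support_smul _ subset_rfl]
      simp [Finset.mul_sum, mul_comm] }

end Correspondence

theorem DenseRange.ext_inner {V : Type u} {F : Type w} [NormedAddCommGroup F]
    [InnerProductSpace ℂ F] {j : V → F} (hj : DenseRange j) {ξ η : F}
    (h : ∀ v, ⟪j v, ξ⟫_ℂ = ⟪j v, η⟫_ℂ) : ξ = η :=
  ext_inner_left ℂ fun ζ => congrFun (hj.equalizer (g := fun ζ => ⟪ζ, ξ⟫_ℂ)
    (h := fun ζ => ⟪ζ, η⟫_ℂ) (by fun_prop) (by fun_prop) (funext h)) ζ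

namespace Correspondence

variable {A : Type u} {X : Type v} [NonUnitalCStarAlgebra A]
  [NormedAddCommGroup X] [NormedSpace ℂ X] [CompleteSpace X] (c : Correspondence A X)
  {K : Type w} [NormedAddCommGroup K] [InnerProductSpace ℂ K] [CompleteSpace K]
  (σ : A →⋆ₙₐ[ℂ] (K →L[ℂ] K))

/-- The left action of `A` on an elementary tensor. -/
def fockActWord (a : A) : List X → K →ₗ[ℂ] (List X →₀ K)
  | [] => Finsupp.lsingle [] ∘ₗ (σ a).toLinearMap
  | x :: w => Finsupp.lsingle (c.lact a x :: w)

/-- The left action of `A` on the algebraic Fock space. -/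
def fockAct (a : A) : (List X →₀ K) →ₗ[ℂ] (List X →₀ K) :=
  Finsupp.lsum ℂ (c.fockActWord σ a)

/-- The creation operators on the algebraic Fock space. -/
def fockCreate {X : Type v} (K : Type w) [NormedAddCommGroup K] [InnerProductSpace ℂ K] (x : X) :
    (List X →₀ K) →ₗ[ℂ] (List X →₀ K) :=
  Finsupp.lmapDomain K ℂ (List.cons x)

/-- The annihilation operators on elementary tensors. -/
def fockAnnihilateWord (x : X) : List X → K →ₗ[ℂ] (List X →₀ K)
  | [] => 0
  | y :: w => c.fockActWord σ (c.inner x y) w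

/-- The annihilation operators on the algebraic Fock space. -/
def fockAnnihilate (x : X) : (List X →₀ K) →ₗ[ℂ] (List X →₀ K) :=
  Finsupp.lsum ℂ (c.fockAnnihilateWord σ x)

theorem fockAct_single_nil (a : A) (h : K) :
    c.fockAct σ a (.single [] h) = .single [] (σ a h) := by
  simp [fockAct, fockActWord]

theorem fockAct_single_cons (a : A) (x : X) (w : List X) (h : K) :
    c.fockAct σ a (.single (x :: w) h) = .single (c.lact a x :: w) h := by
  simp [fockAct, fockActWord]

theorem fockCreate_single {X : Type v} {K : Type w} [NormedAddCommGroup K]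
    [InnerProductSpace ℂ K] (x : X) (w : List X) (h : K) :
    fockCreate K x (.single w h) = .single (x :: w) h := by
  simp [fockCreate]

theorem fockAnnihilate_single_nil (x : X) (h : K) :
    c.fockAnnihilate σ x (.single [] h) = 0 := by
  simp [fockAnnihilate, fockAnnihilateWord]

theorem fockAnnihilate_single_cons (x y : X) (w : List X) (h : K) :
    c.fockAnnihilate σ x (.single (y :: w) h) = c.fockAct σ (c.inner x y) (.single w h) := by
  simp [fockAnnihilate, fockAnnihilateWord, fockAct]

theorem exists_fock : ∃ (F : Type (max v w)) (_ : NormedAddCommGroup F)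
    (_ : InnerProductSpace ℂ F) (_ : CompleteSpace F) (T : ToeplitzPair c (F →L[ℂ] F))
    (e : K →ₗ[ℂ] F), (∀ h k, ⟪e h, e k⟫_ℂ = ⟪h, k⟫_ℂ) ∧ (∀ a h, T.p0 a (e h) = e (σ a h)) ∧
      ∀ x h, star (T.p1 x) (e h) = 0 := by
  obtain ⟨F, _, _, _, j, hj, hij⟩ := exists_hilbert_completion _ (c.fockCore σ)
  have hE : ∀ w w' h h', ⟪j (.single w h), j (.single w' h')⟫_ℂ = ⟪h, c.wordKernel σ w w' h'⟫_ℂ :=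
    fun w w' h h' => by
      rw [hij]
      change Finsupp.sum _ _ = _
      simp
  have hext : ∀ {P Q : F →L[ℂ] F}, (∀ w h, P (j (.single w h)) = Q (j (.single w h))) → P = Q :=
    fun {P Q} hPQ => ContinuousLinearMap.ext_denseRange hj fun v => by
      induction v using Finsupp.induction_linear with
      | zero => simp
      | add u v hu hv => simp [hu, hv]
      | single w h => exact hPQ w h
  have hvec : ∀ {ξ η : F}, (∀ w h, ⟪j (.single w h), ξ⟫_ℂ = ⟪j (.single w h), η⟫_ℂ) → ξ = η :=
    fun {ξ η} hξ => by
      refine hj.ext_inner fun v => ?_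
      induction v using Finsupp.induction_linear with
      | zero => simp
      | add u v hu hv => simp_all
      | single w h => exact hξ w h
  have hadj : ∀ f g : (List X →₀ K) →ₗ[ℂ] (List X →₀ K),
      (∀ w w' h h', ⟪j (f (.single w h)), j (.single w' h')⟫_ℂ =
        ⟪j (.single w h), j (g (.single w' h'))⟫_ℂ) → ∀ u v, ⟪j (f u), j v⟫_ℂ = ⟪j u, j (g v)⟫_ℂ :=
    fun f g hfg u v => by
      induction u using Finsupp.induction_linear with
      | zero => simp
      | add u u' hu hu' => simp [hu, hu']
      | single w h =>
        induction v using Finsupp.induction_linear with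
        | zero => simp
        | add v v' hv hv' => simp [hv, hv']
        | single w' h' => exact hfg w w' h h'
  have hcons_add : ∀ x y w h, j (.single ((x + y) :: w) h) =
      j (.single (x :: w) h) + j (.single (y :: w) h) := fun x y w h => hvec fun w' h' => by
    rw [inner_add_right, hE, hE, hE, ← inner_add_right]
    cases w' with
    | nil => simp [wordKernel]
    | cons z w' => simp [wordKernel, c.inner_add_right, wordForm_add, inner_add_right]
  have hcons_smul : ∀ (z : ℂ) x w h, j (.single ((z • x) :: w) h) = z • j (.single (x :: w) h) :=
    fun z x w h => hvec fun w' h' => by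
      rw [inner_smul_right, hE, hE, ← inner_smul_right]
      cases w' with
      | nil => simp [wordKernel]
      | cons y w' => simp [wordKernel, c.inner_csmul_right, wordForm_smul]
  have hlin : ∀ f g : (List X →₀ K) →ₗ[ℂ] F, (∀ w h, f (.single w h) = g (.single w h)) → f = g :=
    fun f g hfg => Finsupp.lhom_ext hfg
  obtain ⟨π, hπ⟩ := exists_rep j hj (c.fockAct σ)
    (fun a b v => by
      refine LinearMap.congr_fun (f := j ∘ₗ c.fockAct σ (a + b))
        (g := j ∘ₗ c.fockAct σ a + j ∘ₗ c.fockAct σ b) (hlin _ _ fun w h => ?_) v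
      cases w with
      | nil => simp [fockAct_single_nil]
      | cons x w => simp [fockAct_single_cons, c.lact_add, hcons_add])
    (fun z a v => by
      refine LinearMap.congr_fun (f := j ∘ₗ c.fockAct σ (z • a))
        (g := z • j ∘ₗ c.fockAct σ a) (hlin _ _ fun w h => ?_) v
      cases w with
      | nil => simp [fockAct_single_nil, ← Finsupp.smul_single]
      | cons x w => simp [fockAct_single_cons, c.lact_csmul, hcons_smul])
    (fun a b v => by
      refine LinearMap.congr_fun (f := j ∘ₗ c.fockAct σ (a * b))
        (g := j ∘ₗ c.fockAct σ a ∘ₗ c.fockAct σ b) (hlin _ _ fun w h => ?_) v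
      cases w with
      | nil => simp [fockAct_single_nil]
      | cons x w => simp [fockAct_single_cons, c.lact_mul])
    (fun a => hadj _ _ fun w w' h h' => by
      rcases w with _ | ⟨x, w⟩ <;> rcases w' with _ | ⟨y, w'⟩ <;>
        simp [fockAct_single_nil, fockAct_single_cons, hE, wordKernel, inner_rep_left,
          c.lact_adjoint])
  have hV : ∀ x u v, ⟪j (fockCreate K x u), j v⟫_ℂ = ⟪j u, j (c.fockAnnihilate σ x v)⟫_ℂ :=
    fun x => hadj _ _ fun w w' h h' => by
      rw [fockCreate_single, hE]
      cases w' with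
      | nil => simp [fockAnnihilate_single_nil, wordKernel]
      | cons y w' =>
        rw [fockAnnihilate_single_cons]
        rcases w with _ | ⟨x', w⟩ <;> rcases w' with _ | ⟨y', w'⟩ <;>
          simp [fockAct_single_nil, fockAct_single_cons, hE, wordKernel, wordForm]
  have hVV : ∀ x y v, c.fockAnnihilate σ x (fockCreate K y v) = c.fockAct σ (c.inner x y) v :=
    fun x y v => by
      refine LinearMap.congr_fun (f := c.fockAnnihilate σ x ∘ₗ fockCreate K y)
        (g := c.fockAct σ (c.inner x y)) (Finsupp.lhom_ext fun w h => ?_) v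
      simp [fockCreate_single, fockAnnihilate_single_cons]
  have hbound : ∀ x v, ‖j (fockCreate K x v)‖ ≤ √‖π (c.inner x x)‖ * ‖j v‖ := fun x v => by
    refine le_of_sq_le_sq ?_ (by positivity)
    rw [mul_pow, Real.sq_sqrt (norm_nonneg _), ← inner_self_eq_norm_sq (𝕜 := ℂ), hV, hVV, ← hπ]
    refine (RCLike.re_le_norm _).trans ((norm_inner_le_norm _ _).trans ?_)
    have := (π (c.inner x x)).le_opNorm (j v)
    nlinarith [norm_nonneg (j v)]
  let V : X → F →L[ℂ] F := fun x => (j ∘ₗ fockCreate K x).extendOfNorm j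
  have hVj : ∀ x v, V x (j v) = j (fockCreate K x v) := fun x v =>
    LinearMap.extendOfNorm_eq hj ⟨_, hbound x⟩ v
  have hVs : ∀ x v, star (V x) (j v) = j (c.fockAnnihilate σ x v) := fun x v => by
    refine hj.ext_inner fun u => ?_
    rw [ContinuousLinearMap.star_eq_adjoint, ContinuousLinearMap.adjoint_inner_right, hVj, hV]
  refine ⟨F, inferInstance, inferInstance, inferInstance,
    { p0 := π
      p1 := { toFun := V, map_add' := fun x y => hext fun w h => ?_,
              map_smul' := fun z x => hext fun w h => ?_ }
      p0_mul_p1 := fun a x => hext fun w h => ?_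
      star_p1_mul_p1 := fun x y => hext fun w h => ?_ },
    j ∘ₗ Finsupp.lsingle [], fun h k => ?_, fun a h => ?_, fun x h => ?_⟩
  · simp [hVj, fockCreate_single, hcons_add]
  · simp [hVj, fockCreate_single, hcons_smul]
  · simp [hVj, hπ, fockCreate_single, fockAct_single_cons]
  · simp [hVj, hVs, hπ, hVV]
  · simp [hE, wordKernel]
  · simp [hπ, fockAct_single_nil]
  · simpa [fockAnnihilate_single_nil] using hVs x (.single [] h)

end Correspondence

namespace HilbertModule

variable {A : Type u} {X : Type v} [NonUnitalCStarAlgebra A]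
  [NormedAddCommGroup X] [NormedSpace ℂ X] [CompleteSpace X] (M : HilbertModule A X)

theorem inner_add_left (x y z : X) : M.inner (x + y) z = M.inner x z + M.inner y z := by
  rw [← M.star_inner, M.inner_add_right, star_add, M.star_inner, M.star_inner]

theorem inner_csmul_left (z : ℂ) (x y : X) : M.inner (z • x) y = star z • M.inner x y := by
  rw [← M.star_inner, M.inner_csmul_right, star_smul, M.star_inner]

theorem rankOne_apply (x y z : X) : M.rankOne x y z = M.smulR x (M.inner y z) := rfl

theorem inner_rankOne_left (x y z w : X) :
    M.inner (M.rankOne x y z) w = M.inner z (M.rankOne y x w) := by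
  rw [rankOne_apply, rankOne_apply, inner_smulR_left, M.inner_smulR_right, M.star_inner]

theorem norm_adjoint_le {S S' : X →L[ℂ] X} (h : ∀ x y, M.inner (S x) y = M.inner x (S' y)) :
    ‖S'‖ ≤ ‖S‖ := by
  refine S'.opNorm_le_bound (norm_nonneg S) fun x => ?_
  by_cases h0 : ‖S' x‖ = 0
  · rw [h0]; positivity
  have h1 : ‖S' x‖ ^ 2 ≤ ‖S‖ * ‖S' x‖ * ‖x‖ := by
    rw [M.norm_sq_eq_norm_inner_self, ← h]
    exact (M.norm_inner_le _ _).trans (by gcongr; exact S.le_opNorm _)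
  have h2 : 0 < ‖S' x‖ := lt_of_le_of_ne (norm_nonneg _) (Ne.symm h0)
  nlinarith

/-- The finite-rank operator attached to a formal combination of rank-one operators. -/
def finiteRank : (X × X →₀ ℂ) →ₗ[ℂ] (X →L[ℂ] X) :=
  Finsupp.linearCombination ℂ fun p => M.rankOne p.1 p.2

theorem finiteRank_single (p : X × X) (z : ℂ) :
    M.finiteRank (.single p z) = z • M.rankOne p.1 p.2 := by
  simp [finiteRank]

theorem coe_compacts :
    (M.compacts : Set (X →L[ℂ] X)) = closure (Set.range M.finiteRank) := by
  rw [compacts, Submodule.topologicalClosure_coe, finiteRank,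
    ← Finsupp.range_linearCombination, LinearMap.coe_range]

theorem isClosed_compacts : IsClosed (M.compacts : Set (X →L[ℂ] X)) :=
  Submodule.isClosed_topologicalClosure _

theorem finiteRank_mem_compacts (e : X × X →₀ ℂ) : M.finiteRank e ∈ M.compacts := by
  rw [← SetLike.mem_coe, coe_compacts]
  exact subset_closure ⟨e, rfl⟩

/-- The finite-rank operators, as compact operators. -/
def finiteRankCompact : (X × X →₀ ℂ) →ₗ[ℂ] M.compacts :=
  M.finiteRank.codRestrict M.compacts M.finiteRank_mem_compacts

theorem denseRange_finiteRankCompact : DenseRange M.finiteRankCompact := by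
  intro k
  rw [Topology.IsInducing.subtypeVal.closure_eq_preimage_closure_image, Set.mem_preimage,
    ← Set.range_comp]
  exact (M.coe_compacts ▸ k.2 : k.1 ∈ closure (Set.range M.finiteRank))

theorem compacts_ext {E : Type w} [NormedAddCommGroup E] [NormedSpace ℂ E]
    {Φ Ψ : M.compacts →L[ℂ] E}
    (h : ∀ x y, Φ ⟨M.rankOne x y, M.rankOne_mem_compacts x y⟩ =
      Ψ ⟨M.rankOne x y, M.rankOne_mem_compacts x y⟩) : Φ = Ψ := by
  refine ContinuousLinearMap.ext_denseRange M.denseRange_finiteRankCompact fun e => ?_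
  refine LinearMap.congr_fun (f := Φ.toLinearMap ∘ₗ M.finiteRankCompact)
    (g := Ψ.toLinearMap ∘ₗ M.finiteRankCompact) (Finsupp.lhom_ext fun p z => ?_) e
  have : M.finiteRankCompact (.single p z) =
      z • ⟨M.rankOne p.1 p.2, M.rankOne_mem_compacts p.1 p.2⟩ :=
    Subtype.ext (M.finiteRank_single p z)
  change Φ _ = Ψ _
  rw [this, map_smul, map_smul, h]

/-- The formal adjoint of a formal combination of rank-one operators. -/
def formalAdjoint : (X × X →₀ ℂ) →+ (X × X →₀ ℂ) :=
  Finsupp.liftAddHom fun p => (Finsupp.singleAddHom (p.2, p.1)).comp (starAddEquiv (R := ℂ))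

theorem formalAdjoint_single {X : Type v} (p : X × X) (z : ℂ) :
    formalAdjoint (.single p z) = .single (p.2, p.1) (star z) := by
  simp [formalAdjoint]

theorem inner_finiteRank_left (e : X × X →₀ ℂ) (x y : X) :
    M.inner (M.finiteRank e x) y = M.inner x (M.finiteRank (formalAdjoint e) y) := by
  induction e using Finsupp.induction_linear with
  | zero => simp [inner_zero_left, inner_zero_right]
  | add e f he hf => simp [inner_add_left, M.inner_add_right, he, hf]
  | single p z =>
    simp [finiteRank_single, inner_csmul_left, M.inner_csmul_right, inner_rankOne_left,
      formalAdjoint_single]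

theorem adjoint_mem_compacts {S S' : X →L[ℂ] X} (hS : S ∈ M.compacts)
    (h : ∀ x y, M.inner (S x) y = M.inner x (S' y)) : S' ∈ M.compacts := by
  rw [← SetLike.mem_coe, coe_compacts, Metric.mem_closure_range_iff] at hS ⊢
  intro ε hε
  obtain ⟨e, he⟩ := hS ε hε
  refine ⟨formalAdjoint e, ?_⟩
  rw [dist_eq_norm] at he ⊢
  refine (M.norm_adjoint_le (S := S - M.finiteRank e) fun x y => ?_).trans_lt he
  rw [_root_.sub_apply, _root_.sub_apply, inner_sub_right, ← M.star_inner,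
    inner_sub_right, star_sub, M.star_inner, M.star_inner, h,
    inner_finiteRank_left]

end HilbertModule

theorem Submodule.exists_extension {V : Type u} {W : Type v} {E : Type w} [NormedAddCommGroup V]
    [NormedSpace ℂ V] [NormedAddCommGroup W] [NormedSpace ℂ W] [CompleteSpace W] [AddCommGroup E]
    [Module ℂ E] (S : Submodule ℂ V) {e : E →ₗ[ℂ] S} (he : DenseRange e) (f : E →ₗ[ℂ] W)
    (h : ∀ x, ‖f x‖ ≤ ‖(e x : V)‖) : ∃ Φ : S →L[ℂ] W, ∀ x, Φ (e x) = f x :=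
  ⟨f.extendOfNorm e, LinearMap.extendOfNorm_eq he ⟨1, fun x => (h x).trans_eq (one_mul _).symm⟩⟩

theorem le_of_forall_pow_two_pow_le {s t C : ℝ} (ht : 0 ≤ t)
    (h : ∀ n : ℕ, s ^ 2 ^ n ≤ C * t ^ (2 ^ n - 1)) : s ≤ t := by
  refine le_of_forall_pos_le_add fun ε hε => ?_
  by_contra! hlt
  set r := t + ε
  have hr : 0 < r := by positivity
  have h1 : ∀ n : ℕ, (s / r) ^ 2 ^ n ≤ |C| / r := fun n => by
    have hn : 2 ^ n - 1 + 1 = 2 ^ n := Nat.sub_add_cancel Nat.one_le_two_pow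
    rw [div_pow, div_le_div_iff₀ (by positivity) hr, ← hn, pow_succ r, ← mul_assoc, hn]
    refine mul_le_mul_of_nonneg_right ((h n).trans ?_) hr.le
    gcongr
    · exact le_abs_self C
    · exact le_add_of_nonneg_right hε.le
  have h2 : Tendsto (fun n : ℕ => (s / r) ^ 2 ^ n) atTop atTop :=
    (tendsto_pow_atTop_atTop_of_one_lt ((one_lt_div hr).2 hlt)).comp
      (tendsto_pow_atTop_atTop_of_one_lt one_lt_two)
  obtain ⟨n, hn⟩ := (h2.eventually_gt_atTop (|C| / r)).exists
  exact absurd (h1 n) hn.not_ge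

namespace ToeplitzPair

variable {A : Type u} {X : Type v} [NonUnitalCStarAlgebra A]
  [NormedAddCommGroup X] [NormedSpace ℂ X] [CompleteSpace X] {c : Correspondence A X}
  {G : Type w} [NormedAddCommGroup G] [InnerProductSpace ℂ G] [CompleteSpace G]
  (T : ToeplitzPair c (G →L[ℂ] G))

theorem norm_p1_le (x : X) : ‖T.p1 x‖ ≤ ‖x‖ := by
  refine le_of_sq_le_sq ?_ (norm_nonneg x)
  rw [sq, ← CStarRing.norm_star_mul_self, T.star_p1_mul_p1, c.norm_sq_eq_norm_inner_self]
  exact NonUnitalStarAlgHom.norm_apply_le T.p0 _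

theorem norm_p1 (hT : Function.Injective T.p0) (x : X) : ‖T.p1 x‖ = ‖x‖ := by
  refine (sq_eq_sq₀ (norm_nonneg _) (norm_nonneg x)).1 ?_
  rw [sq, ← CStarRing.norm_star_mul_self, T.star_p1_mul_p1, c.norm_sq_eq_norm_inner_self]
  exact NonUnitalStarAlgHom.norm_map T.p0 hT _

theorem continuous_p1 : Continuous T.p1 :=
  AddMonoidHomClass.continuous_of_bound T.p1 1 fun x => by simpa using T.norm_p1_le x

theorem p1_smulR (x : X) (a : A) : T.p1 (c.smulR x a) = T.p1 x * T.p0 a := by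
  have h := T.star_p1_mul_p1
  have h2 : star (T.p1 (c.smulR x a)) * (T.p1 x * T.p0 a) =
      T.p0 (c.inner (c.smulR x a) x) * T.p0 a := by rw [← mul_assoc, h]
  have h3 : star (T.p0 a) * star (T.p1 x) * T.p1 (c.smulR x a) =
      star (T.p0 a) * T.p0 (c.inner x (c.smulR x a)) := by rw [mul_assoc, h]
  have h4 : star (T.p0 a) * star (T.p1 x) * (T.p1 x * T.p0 a) =
      star (T.p0 a) * (T.p0 (c.inner x x) * T.p0 a) := by
    rw [mul_assoc, ← mul_assoc _ _ (T.p0 a), h]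
  rw [← sub_eq_zero, ← CStarRing.star_mul_self_eq_zero_iff, star_sub, star_mul,
    sub_mul, mul_sub, mul_sub, h, h2, h3, h4, c.inner_smulR_right, c.inner_smulR_left,
    c.inner_smulR_right, ← map_star T.p0]
  simp [mul_assoc]

theorem p1_mul_star_p1_mul_p1 (x y z : X) :
    T.p1 x * star (T.p1 y) * T.p1 z = T.p1 (c.rankOne x y z) := by
  rw [mul_assoc, T.star_p1_mul_p1, HilbertModule.rankOne_apply, p1_smulR]

theorem star_p1_mul_p0 (x : X) (a : A) :
    star (T.p1 x) * T.p0 a = star (T.p1 (c.lact (star a) x)) := by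
  rw [← T.p0_mul_p1, star_mul, map_star, star_star]

/-- The finite-rank operator attached to a formal combination of rank-one operators, as seen by a
Toeplitz pair. -/
def finiteRank : (X × X →₀ ℂ) →ₗ[ℂ] (G →L[ℂ] G) :=
  Finsupp.linearCombination ℂ fun p => T.p1 p.1 * star (T.p1 p.2)

theorem finiteRank_single (p : X × X) (z : ℂ) :
    T.finiteRank (.single p z) = z • (T.p1 p.1 * star (T.p1 p.2)) := by
  simp [finiteRank]

theorem finiteRank_mul_p1 (e : X × X →₀ ℂ) (z : X) :
    T.finiteRank e * T.p1 z = T.p1 (c.finiteRank e z) := by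
  induction e using Finsupp.induction_linear with
  | zero => simp
  | add e f he hf => simp [add_mul, he, hf]
  | single p t =>
    rw [finiteRank_single, HilbertModule.finiteRank_single, smul_mul_assoc, p1_mul_star_p1_mul_p1]
    simp

theorem star_finiteRank (e : X × X →₀ ℂ) :
    star (T.finiteRank e) = T.finiteRank (HilbertModule.formalAdjoint e) := by
  induction e using Finsupp.induction_linear with
  | zero => simp
  | add e f he hf => simp [he, hf]
  | single p z =>
    rw [HilbertModule.formalAdjoint_single, finiteRank_single, finiteRank_single, star_smul,
      star_mul, star_star]

theorem exists_norm_mul_finiteRank_le (e : X × X →₀ ℂ) : ∃ C, ∀ (S : G →L[ℂ] G) (k : X →L[ℂ] X),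
    (∀ z, S * T.p1 z = T.p1 (k z)) → ‖S * T.finiteRank e‖ ≤ C * ‖k‖ := by
  induction e using Finsupp.induction_linear with
  | zero => exact ⟨0, fun S k _ => by simp⟩
  | add e f he hf =>
    obtain ⟨C, hC⟩ := he
    obtain ⟨D, hD⟩ := hf
    refine ⟨C + D, fun S k h => ?_⟩
    rw [map_add, mul_add, add_mul]
    exact norm_add_le_of_le (hC S k h) (hD S k h)
  | single p z =>
    refine ⟨‖z‖ * (‖p.1‖ * ‖p.2‖), fun S k h => ?_⟩
    rw [finiteRank_single, mul_smul_comm, ← mul_assoc, h, norm_smul, mul_assoc]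
    gcongr
    refine (norm_mul_le _ _).trans ?_
    rw [norm_star]
    calc ‖T.p1 (k p.1)‖ * ‖T.p1 p.2‖ ≤ ‖k‖ * ‖p.1‖ * ‖p.2‖ := by
          gcongr
          · exact (T.norm_p1_le _).trans (k.le_opNorm _)
          · exact T.norm_p1_le _
      _ = _ := by ring

theorem norm_finiteRank_le (e : X × X →₀ ℂ) : ‖T.finiteRank e‖ ≤ ‖c.finiteRank e‖ := by
  set S := T.finiteRank e
  set e' := HilbertModule.formalAdjoint e
  set k := c.finiteRank e' * c.finiteRank e
  have hS : star S = T.finiteRank e' := T.star_finiteRank e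
  have hT : ∀ z, star S * S * T.p1 z = T.p1 (k z) := fun z => by
    rw [mul_assoc, T.finiteRank_mul_p1, hS, T.finiteRank_mul_p1]
    rfl
  generalize hQ : star S * S = Q at hT
  have hpow : ∀ (m : ℕ) z, Q ^ m * T.p1 z = T.p1 ((k ^ m) z) := fun m => by
    induction m with
    | zero => simp
    | succ m ih =>
      intro z
      rw [pow_succ, mul_assoc, hT, ih, pow_succ]
      rfl
  obtain ⟨C, hC⟩ := T.exists_norm_mul_finiteRank_le e'
  have hk : ‖k‖ ≤ ‖c.finiteRank e‖ ^ 2 := by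
    refine (norm_mul_le _ _).trans ?_
    rw [sq]
    gcongr
    exact c.norm_adjoint_le (c.inner_finiteRank_left e)
  have hkm : ∀ m : ℕ, ‖k ^ m‖ ≤ (‖c.finiteRank e‖ ^ 2) ^ m := fun m => by
    induction m with
    | zero =>
      rw [pow_zero, pow_zero]
      exact ContinuousLinearMap.norm_id_le
    | succ m ih =>
      rw [pow_succ, pow_succ]
      exact (norm_mul_le _ _).trans (by gcongr)
  refine le_of_sq_le_sq (le_of_forall_pow_two_pow_le (C := |C| * ‖S‖) (sq_nonneg _) fun n => ?_)
    (norm_nonneg _)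
  have hQs : IsSelfAdjoint Q := hQ ▸ IsSelfAdjoint.star_mul_self S
  have hn : 2 ^ n - 1 + 1 = 2 ^ n := Nat.sub_add_cancel Nat.one_le_two_pow
  have h1 : Q ^ 2 ^ n = Q ^ (2 ^ n - 1) * star S * S := by
    rw [mul_assoc, hQ, ← pow_succ, hn]
  have h2 : ‖Q ^ (2 ^ n - 1) * star S‖ ≤ |C| * (‖c.finiteRank e‖ ^ 2) ^ (2 ^ n - 1) := by
    rw [hS]
    refine (hC _ _ (hpow _)).trans ?_
    gcongr
    · exact le_abs_self C
    · exact hkm _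
  rw [sq ‖S‖, ← CStarRing.norm_star_mul_self, hQ, ← hQs.norm_pow_two_pow, h1, mul_right_comm]
  exact (norm_mul_le _ _).trans (by gcongr)

/-- The map `φ_π` on compact operators induced by a Toeplitz pair. -/
theorem exists_compacts_map : ∃ Φ : c.compacts →L[ℂ] (G →L[ℂ] G),
    ∀ x y, Φ ⟨c.rankOne x y, c.rankOne_mem_compacts x y⟩ = T.p1 x * star (T.p1 y) := by
  obtain ⟨Φ, hΦ⟩ := c.compacts.exists_extension c.denseRange_finiteRankCompact T.finiteRank
    T.norm_finiteRank_le
  refine ⟨Φ, fun x y => ?_⟩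
  have h1 : (⟨c.rankOne x y, c.rankOne_mem_compacts x y⟩ : c.compacts) =
      c.finiteRankCompact (.single (x, y) 1) :=
    Subtype.ext (by simp [HilbertModule.finiteRankCompact, HilbertModule.finiteRank_single])
  rw [h1, hΦ, finiteRank_single, one_smul]

end ToeplitzPair

namespace Correspondence

variable {A : Type u} {X : Type v} [NonUnitalCStarAlgebra A]
  [NormedAddCommGroup X] [NormedSpace ℂ X] [CompleteSpace X] (c : Correspondence A X)

theorem rankOne_comp_lact (x y : X) (a : A) :
    (c.rankOne x y).comp (c.lact a) = c.rankOne x (c.lact (star a) y) := by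
  ext z
  simp [HilbertModule.rankOne_apply, c.lact_adjoint]

theorem finiteRank_comp_lact (e : X × X →₀ ℂ) (a : A) : (c.finiteRank e).comp (c.lact a) =
    c.finiteRank (e.mapDomain fun p => (p.1, c.lact (star a) p.2)) := by
  induction e using Finsupp.induction_linear with
  | zero => simp
  | add e f he hf => simp [Finsupp.mapDomain_add, ContinuousLinearMap.add_comp, he, hf]
  | single p z =>
    rw [Finsupp.mapDomain_single, HilbertModule.finiteRank_single,
      HilbertModule.finiteRank_single, ContinuousLinearMap.smul_comp, rankOne_comp_lact]

theorem comp_lact_mem_compacts {k : X →L[ℂ] X} (hk : k ∈ c.compacts) (a : A) :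
    k.comp (c.lact a) ∈ c.compacts := by
  rw [← SetLike.mem_coe, HilbertModule.coe_compacts] at hk ⊢
  refine map_mem_closure (f := fun k : X →L[ℂ] X => k.comp (c.lact a)) (by fun_prop) hk ?_
  rintro _ ⟨e, rfl⟩
  exact ⟨_, (c.finiteRank_comp_lact e a).symm⟩

end Correspondence

section RestrictOperator

variable {G : Type w} [NormedAddCommGroup G] [InnerProductSpace ℂ G]

/-- The restriction of an operator to an invariant subspace. -/
def restrictOperator (S : G →L[ℂ] G) (E : Submodule ℂ G) (hS : ∀ h ∈ E, S h ∈ E) : E →L[ℂ] E :=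
  (S.comp E.subtypeL).codRestrict E fun h => hS h h.2

@[simp]
theorem coe_restrictOperator {S : G →L[ℂ] G} {E : Submodule ℂ G} (hS : ∀ h ∈ E, S h ∈ E) (h : E) :
    (restrictOperator S E hS h : G) = S h :=
  rfl

theorem star_restrictOperator [CompleteSpace G] {S : G →L[ℂ] G} {E : Submodule ℂ G}
    [CompleteSpace E] (hS : ∀ h ∈ E, S h ∈ E) (hS' : ∀ h ∈ E, star S h ∈ E) :
    star (restrictOperator S E hS) = restrictOperator (star S) E hS' := by
  rw [ContinuousLinearMap.star_eq_adjoint]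
  refine ((ContinuousLinearMap.eq_adjoint_iff _ _).2 fun x y => ?_).symm
  rw [Submodule.coe_inner, Submodule.coe_inner, coe_restrictOperator, coe_restrictOperator,
    ContinuousLinearMap.star_eq_adjoint, ContinuousLinearMap.adjoint_inner_left]

theorem exists_restrict_rep {A : Type u} [NonUnitalCStarAlgebra A] [CompleteSpace G]
    (σ : A →⋆ₙₐ[ℂ] (G →L[ℂ] G)) (E : Submodule ℂ G) [CompleteSpace E]
    (hE : ∀ a, ∀ h ∈ E, σ a h ∈ E) :
    ∃ τ : A →⋆ₙₐ[ℂ] (E →L[ℂ] E), ∀ a h, (τ a h : G) = σ a h :=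
  ⟨{  toFun a := restrictOperator (σ a) E (hE a)
      map_smul' z a := by ext; simp
      map_zero' := by ext; simp
      map_add' a b := by ext; simp
      map_mul' a b := by ext; simp
      map_star' a := by
        rw [star_restrictOperator _ fun h hh => by rw [← map_star σ]; exact hE _ h hh]
        ext h
        exact congrArg (· (h : G)) (map_star σ a) }, fun _ _ => rfl⟩

end RestrictOperator

namespace ToeplitzPair

variable {A : Type u} {X : Type v} [NonUnitalCStarAlgebra A]
  [NormedAddCommGroup X] [NormedSpace ℂ X] [CompleteSpace X] {c : Correspondence A X}
  {G : Type w} [NormedAddCommGroup G] [InnerProductSpace ℂ G] [CompleteSpace G]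
  {T : ToeplitzPair c (G →L[ℂ] G)} {Φ : c.compacts →L[ℂ] (G →L[ℂ] G)}

theorem compacts_map_finiteRank
    (hΦ : ∀ x y, Φ ⟨c.rankOne x y, c.rankOne_mem_compacts x y⟩ = T.p1 x * star (T.p1 y))
    (e : X × X →₀ ℂ) : Φ (c.finiteRankCompact e) = T.finiteRank e := by
  refine LinearMap.congr_fun (f := Φ.toLinearMap ∘ₗ c.finiteRankCompact)
    (g := T.finiteRank) (Finsupp.lhom_ext fun p z => ?_) e
  have : c.finiteRankCompact (.single p z) =
      z • ⟨c.rankOne p.1 p.2, c.rankOne_mem_compacts p.1 p.2⟩ :=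
    Subtype.ext (c.finiteRank_single p z)
  change Φ _ = _
  rw [this, map_smul, hΦ, finiteRank_single]

theorem compacts_map_mul_p1
    (hΦ : ∀ x y, Φ ⟨c.rankOne x y, c.rankOne_mem_compacts x y⟩ = T.p1 x * star (T.p1 y))
    (k : c.compacts) (z : X) : Φ k * T.p1 z = T.p1 (k.1 z) := by
  refine congrFun (c.denseRange_finiteRankCompact.equalizer (g := fun k => Φ k * T.p1 z)
    (h := fun k => T.p1 (k.1 z)) (by fun_prop)
    (T.continuous_p1.comp (by fun_prop)) (funext fun e => ?_)) k
  exact (congrArg (· * T.p1 z) (compacts_map_finiteRank hΦ e)).trans (T.finiteRank_mul_p1 e z)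

theorem compacts_map_mul_p0
    (hΦ : ∀ x y, Φ ⟨c.rankOne x y, c.rankOne_mem_compacts x y⟩ = T.p1 x * star (T.p1 y))
    (k : c.compacts) (a : A) :
    Φ k * T.p0 a = Φ ⟨k.1.comp (c.lact a), c.comp_lact_mem_compacts k.2 a⟩ := by
  refine congrFun (c.denseRange_finiteRankCompact.equalizer (g := fun k => Φ k * T.p0 a)
    (h := fun k => Φ ⟨k.1.comp (c.lact a), c.comp_lact_mem_compacts k.2 a⟩) (by fun_prop)
    (Φ.continuous.comp (Continuous.subtype_mk (by fun_prop) _)) (funext fun e => ?_)) k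
  have h1 : (⟨(c.finiteRankCompact e).1.comp (c.lact a),
      c.comp_lact_mem_compacts (c.finiteRankCompact e).2 a⟩ : c.compacts) =
      c.finiteRankCompact (e.mapDomain fun p => (p.1, c.lact (star a) p.2)) :=
    Subtype.ext (c.finiteRank_comp_lact e a)
  simp only [Function.comp_apply]
  rw [h1, compacts_map_finiteRank hΦ, compacts_map_finiteRank hΦ]
  clear h1
  induction e using Finsupp.induction_linear with
  | zero => simp
  | add e f he hf => simp [Finsupp.mapDomain_add, add_mul, he, hf]
  | single p z =>
    rw [Finsupp.mapDomain_single, finiteRank_single, finiteRank_single, smul_mul_assoc, mul_assoc,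
      star_p1_mul_p0]

/-- The composition of a Toeplitz pair with a *-homomorphism. -/
def comp {C : Type w} {D : Type u'} [NonUnitalCStarAlgebra C] [NonUnitalCStarAlgebra D]
    (T : ToeplitzPair c C) (ρ : C →⋆ₙₐ[ℂ] D) : ToeplitzPair c D where
  p0 := ρ.comp T.p0
  p1 := (ρ : C →ₗ[ℂ] D) ∘ₗ T.p1
  p0_mul_p1 a x := by
    change ρ (T.p0 a) * ρ (T.p1 x) = ρ (T.p1 _)
    rw [← map_mul, T.p0_mul_p1]
  star_p1_mul_p1 x y := by
    change star (ρ (T.p1 x)) * ρ (T.p1 y) = ρ (T.p0 _)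
    rw [← map_star, ← map_mul, T.star_p1_mul_p1]

theorem IsCovariant.comp {C : Type w} {D : Type u'} [NonUnitalCStarAlgebra C]
    [NonUnitalCStarAlgebra D] {T : ToeplitzPair c C} (hT : T.IsCovariant) (ρ : C →⋆ₙₐ[ℂ] D) :
    (T.comp ρ).IsCovariant := by
  obtain ⟨Φ, hΦ, hcov⟩ := hT
  refine ⟨((ρ : C →ₗ[ℂ] D).mkContinuous 1 fun x => ?_).comp Φ, fun x y => ?_, fun a ha => ?_⟩
  · rw [one_mul]
    exact NonUnitalStarAlgHom.norm_apply_le ρ x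
  · change ρ (Φ _) = ρ _ * star (ρ _)
    rw [hΦ, map_mul, map_star]
  · change ρ (T.p0 a) = ρ (Φ _)
    rw [hcov a ha]

theorem exists_restrict (T : ToeplitzPair c (G →L[ℂ] G)) (E : Submodule ℂ G) [CompleteSpace E]
    (h0 : ∀ a, ∀ h ∈ E, T.p0 a h ∈ E) (h1 : ∀ x, ∀ h ∈ E, T.p1 x h ∈ E)
    (hs : ∀ x, ∀ h ∈ E, star (T.p1 x) h ∈ E) : ∃ S : ToeplitzPair c (E →L[ℂ] E),
      (∀ a h, (S.p0 a h : G) = T.p0 a h) ∧ (∀ x h, (S.p1 x h : G) = T.p1 x h) ∧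
        ∀ x h, (star (S.p1 x) h : G) = star (T.p1 x) h := by
  obtain ⟨τ, hτ⟩ := exists_restrict_rep T.p0 E h0
  let r : X →ₗ[ℂ] E →L[ℂ] E :=
    { toFun x := restrictOperator (T.p1 x) E (h1 x)
      map_add' x y := by ext; simp
      map_smul' z x := by ext; simp }
  have hr : ∀ x (h : E), (r x h : G) = T.p1 x h := fun x h => rfl
  have hadj : ∀ x (h : E), (star (r x) h : G) = star (T.p1 x) h := fun x h =>
    congrArg (fun S => (S h : G)) (star_restrictOperator (h1 x) (hs x))
  refine ⟨{ p0 := τ, p1 := r, p0_mul_p1 := fun a x => ?_, star_p1_mul_p1 := fun x y => ?_ },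
    hτ, hr, hadj⟩
  · ext h
    rw [mul_apply_eq_comp, hτ, hr, hr]
    exact congrArg (· (h : G)) (T.p0_mul_p1 a x)
  · ext h
    rw [mul_apply_eq_comp, hadj, hr, hτ]
    exact congrArg (· (h : G)) (T.star_p1_mul_p1 x y)

/-- A restriction of a Toeplitz pair is covariant if the covariance relation holds on the
subspace. -/
theorem isCovariant_of_restrict {E : Submodule ℂ G} [CompleteSpace E]
    {S : ToeplitzPair c (E →L[ℂ] E)} (hp0 : ∀ a h, (S.p0 a h : G) = T.p0 a h)
    (hp1 : ∀ x h, (S.p1 x h : G) = T.p1 x h) (hps : ∀ x h, (star (S.p1 x) h : G) = star (T.p1 x) h)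
    (hΦ : ∀ x y, Φ ⟨c.rankOne x y, c.rankOne_mem_compacts x y⟩ = T.p1 x * star (T.p1 y))
    (hcov : ∀ a, (ha : a ∈ c.katsura) → ∀ h ∈ E, T.p0 a h = Φ ⟨c.lact a, ha.1⟩ h) :
    S.IsCovariant := by
  obtain ⟨Ψ, hΨ⟩ := S.exists_compacts_map
  refine ⟨Ψ, hΨ, fun a ha => ?_⟩
  ext h
  rw [hp0, hcov a ha h h.2]
  have h1 : (ContinuousLinearMap.apply ℂ G (h : G)).comp Φ =
      E.subtypeL.comp ((ContinuousLinearMap.apply ℂ E h).comp Ψ) := c.compacts_ext fun x y => by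
    change Φ _ (h : G) = (Ψ _ h : G)
    rw [hΦ, hΨ]
    change _ = (S.p1 x (star (S.p1 y) h) : G)
    rw [hp1, hps]
    rfl
  exact congrArg (· ⟨c.lact a, ha.1⟩) h1

end ToeplitzPair

theorem injective_of_intertwines {A : Type u} [NonUnitalCStarAlgebra A] {K : Type v} {F : Type w}
    [NormedAddCommGroup K] [InnerProductSpace ℂ K] [CompleteSpace K]
    [NormedAddCommGroup F] [InnerProductSpace ℂ F] [CompleteSpace F]
    {σ : A →⋆ₙₐ[ℂ] (K →L[ℂ] K)} {τ : A →⋆ₙₐ[ℂ] (F →L[ℂ] F)} (hσ : Function.Injective σ)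
    {e : K →ₗ[ℂ] F} (he : ∀ h k, ⟪e h, e k⟫_ℂ = ⟪h, k⟫_ℂ) (hτ : ∀ a h, τ a (e h) = e (σ a h)) :
    Function.Injective τ := fun a b hab => hσ <| by
  ext h
  refine (e.isometryOfInner he).injective ?_
  change e _ = e _
  rw [← hτ, ← hτ, hab]

namespace Correspondence

variable {A : Type u} {X : Type v} [NonUnitalCStarAlgebra A]
  [NormedAddCommGroup X] [NormedSpace ℂ X] [CompleteSpace X] (c : Correspondence A X)

theorem lact_zero : c.lact 0 = 0 := by
  simpa using c.lact_csmul 0 0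

theorem lact_star_eq_zero {a : A} (h : c.lact a = 0) : c.lact (star a) = 0 := by
  ext x
  refine c.ext_inner fun y => ?_
  rw [← c.lact_adjoint, h, zero_apply, zero_apply, HilbertModule.inner_zero_left,
    HilbertModule.inner_zero_right]

theorem mul_mem_katsura {a : A} (ha : a ∈ c.katsura) (b : A) : a * b ∈ c.katsura :=
  ⟨by rw [c.lact_mul]; exact c.comp_lact_mem_compacts ha.1 b, fun d hd => by
    rw [mul_assoc]
    exact ha.2 _ (by rw [c.lact_mul, hd, ContinuousLinearMap.comp_zero])⟩

theorem star_mem_katsura {a : A} (ha : a ∈ c.katsura) : star a ∈ c.katsura := by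
  refine ⟨c.adjoint_mem_compacts ha.1 (c.lact_adjoint a), fun b hb => ?_⟩
  rw [← CStarRing.star_mul_self_eq_zero_iff, star_mul, star_star, mul_assoc, ha.2, mul_zero]
  rw [c.lact_mul, hb, ContinuousLinearMap.comp_zero]

theorem norm_lact_le (a : A) : ‖c.lact a‖ ≤ ‖a‖ := by
  obtain ⟨K, _, _, _, σ, hσ⟩ := exists_faithful_rep A
  obtain ⟨F, _, _, _, T, e, he, hTe, -⟩ := c.exists_fock σ
  have hinj := injective_of_intertwines hσ he hTe
  refine (c.lact a).opNorm_le_bound (norm_nonneg a) fun x => ?_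
  rw [← T.norm_p1 hinj, ← T.p0_mul_p1, ← NonUnitalStarAlgHom.norm_map T.p0 hinj a,
    ← T.norm_p1 hinj x]
  exact norm_mul_le _ _

theorem continuous_lact : Continuous c.lact :=
  AddMonoidHomClass.continuous_of_bound
    ({ toFun := c.lact, map_zero' := c.lact_zero, map_add' := c.lact_add } : A →+ (X →L[ℂ] X)) 1
    fun a => (c.norm_lact_le a).trans_eq (one_mul _).symm

/-- The Katsura ideal as a C*-subalgebra. -/
def katsuraSubalgebra : NonUnitalStarSubalgebra ℂ A where
  carrier := c.katsura
  add_mem' {a b} ha hb := ⟨by rw [c.lact_add]; exact add_mem ha.1 hb.1, fun d hd => by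
    rw [add_mul, ha.2 d hd, hb.2 d hd, add_zero]⟩
  zero_mem' := ⟨by rw [c.lact_zero]; exact zero_mem _, fun d _ => zero_mul d⟩
  mul_mem' {a b} ha _ := c.mul_mem_katsura ha b
  smul_mem' z a ha := ⟨by rw [c.lact_csmul]; exact Submodule.smul_mem _ z ha.1, fun d hd => by
    rw [smul_mul_assoc, ha.2 d hd, smul_zero]⟩
  star_mem' := c.star_mem_katsura

theorem isClosed_katsura : IsClosed c.katsura := by
  have : c.katsura = c.lact ⁻¹' c.compacts ∩ ⋂ b, {a | c.lact b = 0 → a * b = 0} := by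
    ext a
    simp [katsura]
  rw [this]
  refine (c.isClosed_compacts.preimage c.continuous_lact).inter (isClosed_iInter fun b => ?_)
  by_cases hb : c.lact b = 0
  · simpa [hb] using isClosed_eq (f := fun a : A => a * b) (by fun_prop) continuous_const
  · simp [hb]

end Correspondence

namespace ToeplitzPair

variable {A : Type u} {X : Type v} [NonUnitalCStarAlgebra A]
  [NormedAddCommGroup X] [NormedSpace ℂ X] [CompleteSpace X] {c : Correspondence A X}
  {G : Type w} [NormedAddCommGroup G] [InnerProductSpace ℂ G] [CompleteSpace G]
  (T : ToeplitzPair c (G →L[ℂ] G)) (Φ : c.compacts →L[ℂ] (G →L[ℂ] G))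

/-- The composition of the annihilation operators along a word. -/
def annihilateWord : List X → G →L[ℂ] G
  | [] => 1
  | x :: w => annihilateWord w * star (T.p1 x)

/-- The largest invariant subspace on which the covariance relation holds. -/
def covariantSubspace : Submodule ℂ G :=
  ⨅ (w : List X) (a : c.katsura),
    ((T.p0 a - Φ ⟨c.lact a, a.2.1⟩) * T.annihilateWord w).toLinearMap.ker

variable {T Φ} in
theorem mem_covariantSubspace {h : G} : h ∈ T.covariantSubspace Φ ↔
    ∀ w, ∀ a, (ha : a ∈ c.katsura) → T.p0 a (T.annihilateWord w h) =
      Φ ⟨c.lact a, ha.1⟩ (T.annihilateWord w h) := by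
  simp [covariantSubspace, sub_eq_zero]

theorem isClosed_covariantSubspace : IsClosed (T.covariantSubspace Φ : Set G) := by
  simp only [covariantSubspace, Submodule.coe_iInf]
  exact isClosed_iInter fun w => isClosed_iInter fun a => ContinuousLinearMap.isClosed_ker _

variable {T Φ}

theorem p0_eq_on_covariantSubspace {h : G} (hh : h ∈ T.covariantSubspace Φ) {a : A}
    (ha : a ∈ c.katsura) : T.p0 a h = Φ ⟨c.lact a, ha.1⟩ h :=
  mem_covariantSubspace.1 hh [] a ha

theorem star_p1_mem_covariantSubspace {h : G} (hh : h ∈ T.covariantSubspace Φ) (x : X) :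
    star (T.p1 x) h ∈ T.covariantSubspace Φ :=
  mem_covariantSubspace.2 fun w => mem_covariantSubspace.1 hh (x :: w)

theorem p0_mem_covariantSubspace
    (hΦ : ∀ x y, Φ ⟨c.rankOne x y, c.rankOne_mem_compacts x y⟩ = T.p1 x * star (T.p1 y))
    {h : G} (hh : h ∈ T.covariantSubspace Φ) (b : A) : T.p0 b h ∈ T.covariantSubspace Φ := by
  refine mem_covariantSubspace.2 fun w a ha => ?_
  cases w with
  | nil =>
    have h1 := mem_covariantSubspace.1 hh [] _ (c.mul_mem_katsura ha b)
    have h2 := compacts_map_mul_p0 hΦ ⟨c.lact a, ha.1⟩ b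
    simp only [← c.lact_mul] at h2
    rw [← h2, map_mul] at h1
    exact h1
  | cons x w =>
    have h1 := mem_covariantSubspace.1 hh (c.lact (star b) x :: w) a ha
    simp only [annihilateWord, ← star_p1_mul_p0] at h1 ⊢
    exact h1

theorem p1_mem_covariantSubspace
    (hΦ : ∀ x y, Φ ⟨c.rankOne x y, c.rankOne_mem_compacts x y⟩ = T.p1 x * star (T.p1 y))
    {h : G} (hh : h ∈ T.covariantSubspace Φ) (x : X) : T.p1 x h ∈ T.covariantSubspace Φ := by
  refine mem_covariantSubspace.2 fun w a ha => ?_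
  cases w with
  | nil =>
    have h1 := (compacts_map_mul_p1 hΦ ⟨c.lact a, ha.1⟩ x).trans (T.p0_mul_p1 a x).symm
    exact congrArg (· h) h1.symm
  | cons y w =>
    have h1 := mem_covariantSubspace.1 (p0_mem_covariantSubspace hΦ hh (c.inner y x)) w a ha
    rw [← T.star_p1_mul_p1] at h1
    exact h1

end ToeplitzPair

theorem CStarLe.trans {A : Type u} [NonUnitalCStarAlgebra A] {a b d : A} (hab : CStarLe a b)
    (hbd : CStarLe b d) : CStarLe a d := by
  let := CStarAlgebra.spectralOrder A
  let := CStarAlgebra.spectralOrderedRing A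
  have h : ∀ {a b : A}, CStarLe a b ↔ a ≤ b := fun {a b} => by
    rw [← sub_nonneg, CStarAlgebra.nonneg_iff_eq_star_mul_self]
    rfl
  rw [h] at *
  exact hab.trans hbd

/-- Positivity of an element of a C*-subalgebra can be tested in the larger algebra. -/
theorem NonUnitalStarSubalgebra.exists_eq_star_mul_self {A : Type u} [NonUnitalCStarAlgebra A]
    (S : NonUnitalStarSubalgebra ℂ A) [IsClosed (S : Set A)] {x : S} {e : A}
    (he : (x : A) = star e * e) : ∃ d : S, x = star d * d := by
  refine IsSelfAdjoint.exists_eq_star_mul_self ?_ fun c d hc hd => ?_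
  · exact Subtype.ext (by simp [he])
  let := CStarAlgebra.spectralOrder A
  let := CStarAlgebra.spectralOrderedRing A
  have h1 : (c : A) * x * c = -(star (d : A) * d) := congrArg Subtype.val hd
  have h2 : 0 ≤ (c : A) * x * c := by
    have hc' : star (c : A) = c := congrArg Subtype.val hc
    have : (c : A) * x * c = star (e * c) * (e * c) := by
      rw [he, star_mul, hc']
      simp only [mul_assoc]
    rw [this]
    exact star_mul_self_nonneg _
  rw [h1, neg_nonneg] at h2
  exact Subtype.ext
    ((CStarRing.star_mul_self_eq_zero_iff _).1 (le_antisymm h2 (star_mul_self_nonneg _)))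

theorem NonUnitalStarSubalgebra.exists_isPosApproxUnit {A : Type u} [NonUnitalCStarAlgebra A]
    (S : NonUnitalStarSubalgebra ℂ A) [IsClosed (S : Set A)] :
    ∃ N, IsPosApproxUnit (S : Set A) N := by
  let := CStarAlgebra.spectralOrder S
  let := CStarAlgebra.spectralOrderedRing S
  have hle : ∀ {a b : S}, CStarLe (a : A) b → a ≤ b := fun {a b} ⟨e, he⟩ => by
    rw [← sub_nonneg]
    exact CStarAlgebra.nonneg_iff_eq_star_mul_self.2
      (S.exists_eq_star_mul_self (x := b - a) he)
  have hge : ∀ {a b : S}, a ≤ b → CStarLe (a : A) b := fun {a b} hab => by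
    rw [← sub_nonneg, CStarAlgebra.nonneg_iff_eq_star_mul_self] at hab
    obtain ⟨d, hd⟩ := hab
    exact ⟨d, congrArg Subtype.val hd⟩
  refine ⟨Subtype.val '' ({x : S | 0 ≤ x} ∩ Metric.ball 0 1), ?_, ?_, ?_, ?_, ?_, ?_⟩
  · rintro _ ⟨x, -, rfl⟩
    exact x.2
  · exact ⟨_, 0, by simp, rfl⟩
  · rintro _ ⟨x, ⟨hx, -⟩, rfl⟩
    obtain ⟨d, hd⟩ := hge hx
    exact ⟨d, by simpa using hd⟩
  · rintro _ ⟨x, ⟨-, hx⟩, rfl⟩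
    exact (mem_ball_zero_iff.1 hx).le
  · rintro _ ⟨x, hx, rfl⟩ _ ⟨y, hy, rfl⟩
    obtain ⟨z, hz, hxz, hyz⟩ := CStarAlgebra.directedOn_nonneg_ball x hx y hy
    exact ⟨z, ⟨z, hz, rfl⟩, hge hxz, hge hyz⟩
  · intro a ha ε hε
    have hl := (CStarAlgebra.increasingApproximateUnit (A := S)).toIsApproximateUnit
    have h1 := ((hl.tendsto_mul_right ⟨a, ha⟩).eventually (Metric.ball_mem_nhds _ hε)).and
      ((hl.tendsto_mul_left ⟨a, ha⟩).eventually (Metric.ball_mem_nhds _ hε))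
    obtain ⟨b₀, ⟨hb₀, hb₀'⟩, hb⟩ :=
      (CStarAlgebra.hasBasis_approximateUnit S).eventually_iff.1 h1
    refine ⟨b₀, ⟨b₀, ⟨hb₀, mem_ball_zero_iff.2 hb₀'⟩, rfl⟩, ?_⟩
    rintro _ ⟨b, ⟨-, hb1⟩, rfl⟩ hle'
    have := hb ⟨hle hle', Metric.ball_subset_closedBall hb1⟩
    rw [dist_eq_norm, dist_eq_norm] at this
    exact this

namespace IsPosApproxUnit

variable {A : Type u} [NonUnitalCStarAlgebra A] {J N : Set A}

theorem exists_filter (hN : IsPosApproxUnit J N) : ∃ l : Filter A, l.NeBot ∧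
    l.HasBasis (· ∈ N) fun b₀ => {b | b ∈ N ∧ CStarLe b₀ b} := by
  have hB : Filter.IsBasis (· ∈ N) fun b₀ => {b | b ∈ N ∧ CStarLe b₀ b} := by
    refine ⟨hN.nonempty, fun {b₁ b₂} h₁ h₂ => ?_⟩
    obtain ⟨b, hb, h₁, h₂⟩ := hN.directed b₁ h₁ b₂ h₂
    exact ⟨b, hb, fun d ⟨hd, hbd⟩ => ⟨⟨hd, h₁.trans hbd⟩, hd, h₂.trans hbd⟩⟩
  refine ⟨hB.filter, hB.hasBasis.neBot_iff.2 fun {b} hb => ⟨b, hb, 0, by simp⟩, hB.hasBasis⟩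

end IsPosApproxUnit

namespace IsPosApproxUnit

variable {A : Type u} [NonUnitalCStarAlgebra A] {J N : Set A} {l : Filter A}

theorem eventually_mem (hN : IsPosApproxUnit J N)
    (hl : l.HasBasis (· ∈ N) fun b₀ => {b | b ∈ N ∧ CStarLe b₀ b}) : ∀ᶠ b in l, b ∈ N := by
  obtain ⟨b, hb⟩ := hN.nonempty
  exact Filter.mem_of_superset (hl.mem_of_mem hb) fun d hd => hd.1

theorem tendsto_mul (hN : IsPosApproxUnit J N)
    (hl : l.HasBasis (· ∈ N) fun b₀ => {b | b ∈ N ∧ CStarLe b₀ b}) {a : A} (ha : a ∈ J) :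
    Tendsto (fun b => b * a) l (𝓝 a) := by
  rw [hl.tendsto_iff Metric.nhds_basis_ball]
  intro ε hε
  obtain ⟨b₀, hb₀, h⟩ := hN.approx a ha ε hε
  exact ⟨b₀, hb₀, fun b hb => mem_ball_iff_norm.2 (h b hb.1 hb.2).1⟩

theorem exists_tendsto {S : NonUnitalStarSubalgebra ℂ A} (hN : IsPosApproxUnit (S : Set A) N)
    (hl : l.HasBasis (· ∈ N) fun b₀ => {b | b ∈ N ∧ CStarLe b₀ b}) {H : Type w}
    [NormedAddCommGroup H] [InnerProductSpace ℂ H] [CompleteSpace H]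
    (σ : A →⋆ₙₐ[ℂ] (H →L[ℂ] H)) : ∃ P : H →L[ℂ] H,
      (∀ h, Tendsto (fun b => σ b h) l (𝓝 (P h))) ∧ ∀ a ∈ S, ∀ h, σ a (P h) = σ a h := by
  set W := (Submodule.span ℂ {k : H | ∃ a ∈ S, ∃ h, k = σ a h}).topologicalClosure
  have : CompleteSpace W := (Submodule.isClosed_topologicalClosure _).completeSpace_coe
  have hbound : ∀ b ∈ N, ∀ h, ‖σ b h‖ ≤ ‖h‖ := fun b hb h =>
    ((σ b).le_of_opNorm_le ((NonUnitalStarAlgHom.norm_apply_le σ b).trans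
      (hN.contractive b hb)) h).trans_eq (one_mul _)
  have hspan : ∀ k ∈ Submodule.span ℂ {k : H | ∃ a ∈ S, ∃ h, k = σ a h},
      Tendsto (fun b => σ b k) l (𝓝 k) := fun k hk => by
    induction hk using Submodule.span_induction with
    | mem k hk =>
      obtain ⟨a, ha, h, rfl⟩ := hk
      have h1 : Continuous σ := AddMonoidHomClass.continuous_of_bound σ 1 fun x => by
        simpa using NonUnitalStarAlgHom.norm_apply_le σ x
      have := (((ContinuousLinearMap.apply ℂ H h).continuous.comp h1).tendsto a).comp
        (hN.tendsto_mul hl ha)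
      simpa [Function.comp_def] using this
    | zero => simpa using tendsto_const_nhds
    | add x y _ _ hx hy => simpa using hx.add hy
    | smul z x _ hx => simpa using hx.const_smul z
  have hW : ∀ k ∈ W, Tendsto (fun b => σ b k) l (𝓝 k) := fun k hk => by
    rw [Metric.tendsto_nhds]
    intro ε hε
    obtain ⟨k', hk', hd⟩ := Metric.mem_closure_iff.1 hk (ε / 3) (by positivity)
    filter_upwards [hN.eventually_mem hl, Metric.tendsto_nhds.1 (hspan k' hk') (ε / 3)
      (by positivity)] with b hb hb'
    calc dist (σ b k) k ≤ dist (σ b k) (σ b k') + dist (σ b k') k' + dist k' k :=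
          dist_triangle4 _ _ _ _
      _ < ε / 3 + ε / 3 + ε / 3 := by
          refine add_lt_add (add_lt_add (lt_of_le_of_lt ?_ hd) hb') (by rwa [dist_comm])
          rw [dist_eq_norm, dist_eq_norm, ← map_sub]
          exact hbound b hb _
      _ = ε := by ring
  have horth : ∀ k ∈ Wᗮ, ∀ a ∈ S, σ a k = 0 := fun k hk a ha => by
    refine ext_inner_left ℂ fun h => ?_
    rw [inner_zero_right, ← star_star a, ← inner_rep_left]
    exact hk _ (Submodule.le_topologicalClosure _
      (Submodule.subset_span ⟨star a, star_mem ha, h, rfl⟩))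
  have hdiff : ∀ h, ∀ a ∈ S, σ a (W.starProjection h) = σ a h := fun h a ha => by
    have := horth _ (W.sub_starProjection_mem_orthogonal h) a ha
    rw [map_sub, sub_eq_zero] at this
    exact this.symm
  refine ⟨W.starProjection, fun h => ?_, fun a ha h => hdiff h a ha⟩
  refine (hW _ (W.starProjection_apply_mem h)).congr' ?_
  filter_upwards [hN.eventually_mem hl] with b hb
  exact hdiff h b (hN.subset hb)

theorem sq_norm_sub_le {H : Type w} [NormedAddCommGroup H] [InnerProductSpace ℂ H]
    [CompleteSpace H] (σ : A →⋆ₙₐ[ℂ] (H →L[ℂ] H)) (hN : IsPosApproxUnit J N) {b b' : A}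
    (hb : b ∈ N) (hbb' : CStarLe b' b) (k : H) :
    ‖k - σ b k‖ ^ 2 ≤ (⟪k, k - σ b' k⟫_ℂ).re := by
  obtain ⟨e, he⟩ := hbb'
  obtain ⟨d, hd⟩ := hN.pos b hb
  have hsq : ∀ a, ⟪k, σ (star a * a) k⟫_ℂ = (‖σ a k‖ : ℂ) ^ 2 := fun a => by
    rw [map_mul, mul_apply_eq_comp, ← inner_rep_left]
    exact inner_self_eq_norm_sq_to_K _
  have h1 : ‖σ b k‖ ^ 2 ≤ ‖σ d k‖ ^ 2 := by
    have h2 : ‖d‖ ≤ 1 := by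
      have := hN.contractive b hb
      rw [hd, CStarRing.norm_star_mul_self] at this
      nlinarith [norm_nonneg d]
    gcongr
    rw [hd, map_mul]
    refine ((σ (star d)).le_of_opNorm_le ((NonUnitalStarAlgHom.norm_apply_le σ _).trans ?_)
      (σ d k)).trans_eq (one_mul _)
    rwa [norm_star]
  have h3 : ‖k - σ b k‖ ^ 2 = ‖k‖ ^ 2 - 2 * ‖σ d k‖ ^ 2 + ‖σ b k‖ ^ 2 := by
    rw [norm_sub_sq (𝕜 := ℂ), hd, hsq]
    simp [← Complex.ofReal_pow]
  have h4 : ⟪k, k - σ b' k⟫_ℂ = (‖k‖ ^ 2 - ‖σ d k‖ ^ 2 + ‖σ e k‖ ^ 2 : ℝ) := by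
    have : b' = b - star e * e := by rw [← he, sub_sub_cancel]
    rw [this, map_sub, _root_.sub_apply, inner_sub_right, inner_sub_right, hd, hsq, hsq,
      inner_self_eq_norm_sq_to_K]
    simp
    ring
  rw [h3, h4, Complex.ofReal_re]
  nlinarith [sq_nonneg ‖σ e k‖]

/-- If an approximate unit fails to act as an approximate left unit on an operator in norm, then it
fails to do so strongly on a suitable ultrapower. -/
theorem exists_not_tendsto (hN : IsPosApproxUnit J N)
    (hl : l.HasBasis (· ∈ N) fun b₀ => {b | b ∈ N ∧ CStarLe b₀ b}) [l.NeBot] {ω : Ultrafilter A}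
    (hω : ω ≤ l) {K : Type w} [NormedAddCommGroup K] [InnerProductSpace ℂ K] [CompleteSpace K]
    {G : Type v} [NormedAddCommGroup G] [InnerProductSpace ℂ G] [CompleteSpace G]
    {ρ : (K →L[ℂ] K) →⋆ₙₐ[ℂ] (G →L[ℂ] G)} {q : boundedFamilies A K →ₗ[ℂ] G}
    (hq : IsUltrapower ω ρ q) (σ : A →⋆ₙₐ[ℂ] (K →L[ℂ] K)) (Y : K →L[ℂ] K) {δ : ℝ} (hδ : 0 < δ)
    (hY : ∀ b ∈ N, δ ≤ ‖Y - σ b * Y‖) :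
    ∃ h, ¬ Tendsto (fun b => ρ (σ b) (ρ Y h)) l (𝓝 (ρ Y h)) := by
  have hex : ∀ b, ∃ h : K, ‖h‖ ≤ 1 ∧ (b ∈ N → δ / 2 ≤ ‖Y h - σ b (Y h)‖) := fun b => by
    by_cases hb : b ∈ N
    · obtain ⟨h, h1, h2⟩ := (Y - σ b * Y).exists_lt_apply_of_lt_opNorm
        ((half_lt_self hδ).trans_le (hY b hb))
      exact ⟨h, h1.le, fun _ => h2.le⟩
    · exact ⟨0, by simp, fun hb' => absurd hb' hb⟩
  choose h hh1 hh2 using hex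
  set h' : boundedFamilies A K := ⟨h, 1, hh1⟩
  refine ⟨q h', fun hlim => ?_⟩
  rw [hq.map_apply] at hlim
  set k := boundedFamilies.map Y h'
  have hk : ∀ b' ∈ N, δ ^ 2 / 4 ≤ (⟪q k, q k - ρ (σ b') (q k)⟫_ℂ).re := fun b' hb' => by
    rw [hq.map_apply, ← map_sub]
    refine ge_of_tendsto ((Complex.continuous_re.tendsto _).comp
      (hq.tendsto_inner k (k - boundedFamilies.map (σ b') k))) ?_
    filter_upwards [hω (hl.mem_of_mem hb')] with b hb
    refine le_trans ?_ (hN.sq_norm_sub_le σ hb.1 hb.2 (k.1 b))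
    have := hh2 b hb.1
    change _ ≤ ‖Y (h b) - σ b (Y (h b))‖ ^ 2
    nlinarith
  have h0 : Tendsto (fun b => (⟪q k, q k - ρ (σ b) (q k)⟫_ℂ).re) l (𝓝 0) := by
    have := (Complex.continuous_re.tendsto _).comp
      (Filter.Tendsto.inner (𝕜 := ℂ) (tendsto_const_nhds (x := q k)) (hlim.const_sub (q k)))
    simpa only [sub_self, inner_zero_right, Complex.zero_re, Function.comp_def] using this
  have := ge_of_tendsto h0 ((hN.eventually_mem hl).mono hk)
  nlinarith [sq_pos_of_pos hδ]

end IsPosApproxUnit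

/-- Every C*-algebra has a faithful representation on which the vectors killed by a given closed
right ideal detect all elements outside of the ideal. -/
theorem NonUnitalStarSubalgebra.exists_faithful_rep_detecting {A : Type u} [NonUnitalCStarAlgebra A]
    (S : NonUnitalStarSubalgebra ℂ A) [hS : IsClosed (S : Set A)]
    (hmul : ∀ b ∈ S, ∀ a, b * a ∈ S) :
    ∃ (K : Type u) (_ : NormedAddCommGroup K) (_ : InnerProductSpace ℂ K) (_ : CompleteSpace K)
      (σ : A →⋆ₙₐ[ℂ] (K →L[ℂ] K)), Function.Injective σ ∧
      ∀ a, a ∉ S → ∃ k, (∀ b ∈ S, σ b k = 0) ∧ σ a k ≠ 0 := by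
  obtain ⟨K, _, _, _, σ, hσ⟩ := exists_faithful_rep A
  obtain ⟨N, hN⟩ := S.exists_isPosApproxUnit
  obtain ⟨l, _, hl⟩ := hN.exists_filter
  obtain ⟨G, _, _, _, ρ, q, hq⟩ := exists_ultrapower (F := K) (Ultrafilter.of l)
  refine ⟨G, _, _, _, ρ.comp σ, hq.injective.comp hσ, fun a ha => ?_⟩
  obtain ⟨δ, hδ, hball⟩ := Metric.isOpen_iff.1 hS.isOpen_compl (star a) fun h =>
    ha (by simpa using star_mem h)
  obtain ⟨h, hh⟩ := hN.exists_not_tendsto hl (Ultrafilter.of_le l) hq σ (σ (star a)) hδ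
    fun b hb => by
      rw [← map_mul, ← map_sub, NonUnitalStarAlgHom.norm_map σ hσ, ← dist_eq_norm, dist_comm]
      exact not_lt.1 fun hlt => hball hlt (hmul b (hN.subset hb) _)
  obtain ⟨P, hP, hPS⟩ := hN.exists_tendsto hl (ρ.comp σ)
  set y := ρ (σ (star a)) h
  have hk : ∀ b ∈ S, ρ.comp σ b (y - P y) = 0 := fun b hb => by
    rw [map_sub, hPS b hb, sub_self]
  refine ⟨y - P y, hk, fun h0 => hh ?_⟩
  have h1 : ⟪y - P y, y⟫_ℂ = 0 := by
    have := inner_rep_left (ρ.comp σ) a (y - P y) h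
    rwa [h0, inner_zero_left, eq_comm] at this
  have h2 : ⟪y - P y, P y⟫_ℂ = 0 := by
    refine tendsto_nhds_unique_of_frequently_eq
      (Filter.Tendsto.inner (𝕜 := ℂ) tendsto_const_nhds (hP y)) tendsto_const_nhds
      ((hN.eventually_mem hl).mono fun b hb => ?_).frequently
    rw [← star_star b, ← inner_rep_left, hk _ (star_mem (hN.subset hb)), inner_zero_left]
  have h3 : P y = y := by
    rw [eq_comm, ← sub_eq_zero, ← inner_self_eq_zero (𝕜 := ℂ), inner_sub_right, h1, h2, sub_zero]
  rw [← h3]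
  nth_rewrite 1 [h3]
  exact hP y

theorem NonUnitalStarSubalgebra.exists_lt_norm_apply {A : Type u} [NonUnitalCStarAlgebra A]
    (S : NonUnitalStarSubalgebra ℂ A) [IsClosed (S : Set A)] {F : Type w} [NormedAddCommGroup F]
    [InnerProductSpace ℂ F] [CompleteSpace F] (σ : A →⋆ₙₐ[ℂ] (F →L[ℂ] F)) (W : Submodule ℂ F)
    [CompleteSpace W] (hW : ∀ a, ∀ h ∈ W, σ a h ∈ W)
    (hinj : ∀ a ∈ S, (∀ h ∈ W, σ a h = 0) → a = 0) {a : A} (ha : a ∈ S) {r : ℝ} (hr : r < ‖a‖) :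
    ∃ h ∈ W, ‖h‖ < 1 ∧ r < ‖σ a h‖ := by
  obtain ⟨τ, hτ⟩ := exists_restrict_rep (σ.comp (NonUnitalStarSubalgebraClass.subtype S)) W
    fun a => hW a
  have hτi : Function.Injective τ := (injective_iff_map_eq_zero τ).2 fun z hz =>
    Subtype.ext <| hinj z z.2 fun h hh => by
      rw [← show _ = σ z h from hτ z ⟨h, hh⟩, hz, zero_apply, ZeroMemClass.coe_zero]
  have hr' : r < ‖τ ⟨a, ha⟩‖ := by rwa [NonUnitalStarAlgHom.norm_map τ hτi]
  obtain ⟨h, h1, h2⟩ := (τ ⟨a, ha⟩).exists_lt_apply_of_lt_opNorm hr'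
  refine ⟨h, h.2, h1, h2.trans_eq (congrArg norm (hτ ⟨a, ha⟩ h))⟩

namespace ToeplitzPair

variable {A : Type u} {X : Type v} [NonUnitalCStarAlgebra A]
  [NormedAddCommGroup X] [NormedSpace ℂ X] [CompleteSpace X] {c : Correspondence A X}
  {G : Type w} [NormedAddCommGroup G] [InnerProductSpace ℂ G] [CompleteSpace G]
  (T : ToeplitzPair c (G →L[ℂ] G)) {Φ : c.compacts →L[ℂ] (G →L[ℂ] G)}

/-- The closed span of the ranges of all products of `n` creation operators. -/
def tail : ℕ → Submodule ℂ G
  | 0 => ⊤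
  | n + 1 => (Submodule.span ℂ {k | ∃ x, ∃ h ∈ tail n, k = T.p1 x h}).topologicalClosure

theorem isClosed_tail : ∀ n, IsClosed (T.tail n : Set G)
  | 0 => isClosed_univ
  | _ + 1 => Submodule.isClosed_topologicalClosure _

instance (n : ℕ) : CompleteSpace (T.tail n) :=
  (T.isClosed_tail n).completeSpace_coe

theorem p1_mem_tail {n : ℕ} {h : G} (hh : h ∈ T.tail n) (x : X) : T.p1 x h ∈ T.tail (n + 1) :=
  Submodule.le_topologicalClosure _ (Submodule.subset_span ⟨x, h, hh, rfl⟩)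

theorem tail_succ_le {n : ℕ} {W : Submodule ℂ G} (hW : IsClosed (W : Set G))
    (h : ∀ x, ∀ h ∈ T.tail n, T.p1 x h ∈ W) : T.tail (n + 1) ≤ W := by
  refine Submodule.topologicalClosure_minimal _ (Submodule.span_le.2 ?_) hW
  rintro _ ⟨x, k, hk, rfl⟩
  exact h x k hk

theorem tail_antitone : Antitone T.tail := by
  refine antitone_nat_of_succ_le fun n => ?_
  induction n with
  | zero => exact le_top
  | succ n ih => exact T.tail_succ_le (T.isClosed_tail _) fun x h hh => T.p1_mem_tail (ih hh) x

theorem p0_mem_tail (a : A) {n : ℕ} {h : G} (hh : h ∈ T.tail n) : T.p0 a h ∈ T.tail n := by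
  cases n with
  | zero => trivial
  | succ n =>
    refine T.tail_succ_le (W := (T.tail (n + 1)).comap (T.p0 a).toLinearMap)
      ((T.isClosed_tail (n + 1)).preimage (T.p0 a).continuous) (fun x k hk => ?_) hh
    change (T.p0 a * T.p1 x) k ∈ T.tail (n + 1)
    rw [p0_mul_p1]
    exact T.p1_mem_tail hk _

theorem star_p1_mem_tail (x : X) {n : ℕ} {h : G} (hh : h ∈ T.tail (n + 1)) :
    star (T.p1 x) h ∈ T.tail n := by
  refine T.tail_succ_le (W := (T.tail n).comap (star (T.p1 x)).toLinearMap)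
    ((T.isClosed_tail n).preimage (star (T.p1 x)).continuous) (fun y k hk => ?_) hh
  change (star (T.p1 x) * T.p1 y) k ∈ T.tail n
  rw [star_p1_mul_p1]
  exact T.p0_mem_tail _ hk

theorem annihilateWord_mem_tail (w : List X) {n : ℕ} {h : G} (hh : h ∈ T.tail (n + w.length)) :
    T.annihilateWord w h ∈ T.tail n := by
  induction w generalizing h with
  | nil => exact hh
  | cons x w ih => exact ih (T.star_p1_mem_tail x hh)

variable {T}

theorem p0_eq_on_tail
    (hΦ : ∀ x y, Φ ⟨c.rankOne x y, c.rankOne_mem_compacts x y⟩ = T.p1 x * star (T.p1 y))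
    {h : G} (hh : h ∈ T.tail 1) {a : A} (ha : a ∈ c.katsura) :
    T.p0 a h = Φ ⟨c.lact a, ha.1⟩ h := by
  have : T.tail 1 ≤ (T.p0 a - Φ ⟨c.lact a, ha.1⟩).toLinearMap.ker :=
    T.tail_succ_le (ContinuousLinearMap.isClosed_ker _) fun x k _ => by
      have h1 := (T.p0_mul_p1 a x).trans (compacts_map_mul_p1 hΦ ⟨c.lact a, ha.1⟩ x).symm
      change T.p0 a _ - Φ _ _ = 0
      exact sub_eq_zero.2 (congrArg (· k) h1)
  exact sub_eq_zero.1 (this hh)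

/-- A set of elements of the Katsura ideal which is invariant under compressions to the
correspondence acts faithfully on the tails of a faithful Toeplitz pair. -/
theorem eq_zero_of_p0_tail_eq_zero (hT : Function.Injective T.p0) {Z : Set A}
    (hZ : Z ⊆ c.katsura) (hinner : ∀ z ∈ Z, ∀ x y, c.inner x (c.lact z y) ∈ Z) (n : ℕ) :
    ∀ z ∈ Z, (∀ h ∈ T.tail n, T.p0 z h = 0) → z = 0 := by
  induction n with
  | zero =>
    refine fun z _ h => hT ?_
    ext k
    rw [h k trivial, map_zero, zero_apply]
  | succ n ih =>
    intro z hz h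
    have h1 : c.lact z = 0 := by
      ext y
      refine c.ext_inner fun x => ?_
      rw [zero_apply, HilbertModule.inner_zero_right]
      refine ih _ (hinner z hz x y) fun k hk => ?_
      rw [← star_p1_mul_p1, ← p0_mul_p1]
      change star (T.p1 x) (T.p0 z (T.p1 y k)) = 0
      rw [h _ (T.p1_mem_tail hk y), map_zero]
    rw [← CStarRing.mul_star_self_eq_zero_iff]
    exact (hZ hz).2 _ (c.lact_star_eq_zero h1)

/-- The elements acting trivially on an invariant subspace. -/
def kernelOn (T : ToeplitzPair c (G →L[ℂ] G)) (E : Submodule ℂ G)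
    (hE : ∀ a, ∀ h ∈ E, T.p0 a h ∈ E) : NonUnitalStarSubalgebra ℂ A where
  carrier := {a | ∀ h ∈ E, T.p0 a h = 0}
  add_mem' {a b} ha hb h hh := by rw [map_add, add_apply, ha h hh, hb h hh, add_zero]
  zero_mem' h hh := by rw [map_zero, zero_apply]
  mul_mem' {a b} ha hb h hh := by rw [map_mul, mul_apply_eq_comp, hb h hh, map_zero]
  smul_mem' z a ha h hh := by rw [map_smul, smul_apply, ha h hh, smul_zero]
  star_mem' {a} ha h hh := by
    rw [← inner_self_eq_zero (𝕜 := ℂ), inner_rep_left T.p0, star_star, ha _ (hE _ _ hh),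
      inner_zero_right]

theorem isClosed_kernelOn (T : ToeplitzPair c (G →L[ℂ] G)) {E : Submodule ℂ G}
    (hE : ∀ a, ∀ h ∈ E, T.p0 a h ∈ E) : IsClosed (T.kernelOn E hE : Set A) := by
  have : (T.kernelOn E hE : Set A) = ⋂ h ∈ E, {a | T.p0 a h = 0} :=
    Set.ext fun a => by rw [mem_iInter₂]; rfl
  rw [this]
  refine isClosed_biInter fun h _ => isClosed_eq ?_ continuous_const
  exact (ContinuousLinearMap.apply ℂ G h).continuous.comp
    (AddMonoidHomClass.continuous_of_bound T.p0 1 fun a => by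
      simpa using NonUnitalStarAlgHom.norm_apply_le T.p0 a)

theorem inner_lact_mem_kernelOn (T : ToeplitzPair c (G →L[ℂ] G)) {E : Submodule ℂ G}
    (hE : ∀ a, ∀ h ∈ E, T.p0 a h ∈ E) (h1 : ∀ x, ∀ h ∈ E, T.p1 x h ∈ E) {z : A}
    (hz : z ∈ T.kernelOn E hE) (x y : X) : c.inner x (c.lact z y) ∈ T.kernelOn E hE := by
  intro h hh
  rw [← star_p1_mul_p1, ← p0_mul_p1]
  change star (T.p1 x) (T.p0 z (T.p1 y h)) = 0
  rw [hz _ (h1 y h hh), map_zero]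

end ToeplitzPair

namespace IsUltrapower

variable {ι : Type*} {F : Type w} {G : Type u'} [NormedAddCommGroup F] [InnerProductSpace ℂ F]
  [CompleteSpace F] [NormedAddCommGroup G] [InnerProductSpace ℂ G] [CompleteSpace G]
  {ω : Ultrafilter ι} {ρ : (F →L[ℂ] F) →⋆ₙₐ[ℂ] (G →L[ℂ] G)} {q : boundedFamilies ι F →ₗ[ℂ] G}

theorem congr_eventually (hq : IsUltrapower ω ρ q) {h k : boundedFamilies ι F}
    (hhk : ∀ᶠ i in ω, h.1 i = k.1 i) : q h = q k := by
  rw [← sub_eq_zero, ← map_sub, ← norm_eq_zero]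
  refine tendsto_nhds_unique_of_frequently_eq (hq.tendsto_norm _) tendsto_const_nhds
    (hhk.mono fun i hi => ?_).frequently
  simp [hi]

variable {A : Type u} {X : Type v} [NonUnitalCStarAlgebra A]
  [NormedAddCommGroup X] [NormedSpace ℂ X] [CompleteSpace X] {c : Correspondence A X}
  {T : ToeplitzPair c (F →L[ℂ] F)} {Φ : c.compacts →L[ℂ] (F →L[ℂ] F)}
  {Ψ : c.compacts →L[ℂ] (G →L[ℂ] G)}

theorem annihilateWord_comp (hq : IsUltrapower ω ρ q) (w : List X) (h : boundedFamilies ι F) :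
    (T.comp ρ).annihilateWord w (q h) = q (boundedFamilies.map (T.annihilateWord w) h) := by
  induction w generalizing h with
  | nil => rfl
  | cons x w ih =>
    have h1 : star ((T.comp ρ).p1 x) = ρ (star (T.p1 x)) := (map_star ρ _).symm
    simp only [ToeplitzPair.annihilateWord, mul_apply_eq_comp]
    rw [h1, hq.map_apply, ih]
    rfl

theorem mem_covariantSubspace (hq : IsUltrapower ω ρ q) (hΨ : ∀ k, Ψ k = ρ (Φ k))
    {h : boundedFamilies ι F} (hh : ∀ w, ∀ a, (ha : a ∈ c.katsura) → ∀ᶠ i in ω,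
      T.p0 a (T.annihilateWord w (h.1 i)) = Φ ⟨c.lact a, ha.1⟩ (T.annihilateWord w (h.1 i))) :
    q h ∈ (T.comp ρ).covariantSubspace Ψ := by
  refine ToeplitzPair.mem_covariantSubspace.2 fun w a ha => ?_
  rw [hΨ, hq.annihilateWord_comp]
  change ρ (T.p0 a) _ = _
  rw [hq.map_apply, hq.map_apply]
  exact hq.congr_eventually (hh w a ha)

end IsUltrapower

namespace Correspondence

variable {A : Type u} {X : Type v} [NonUnitalCStarAlgebra A]
  [NormedAddCommGroup X] [NormedSpace ℂ X] [CompleteSpace X] (c : Correspondence A X)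

/-- Every C*-correspondence has an injective covariant Toeplitz pair on a Hilbert space. -/
theorem exists_covariant_injective :
    ∃ (H : Type (max u v)) (_ : NormedAddCommGroup H) (_ : InnerProductSpace ℂ H)
      (_ : CompleteSpace H) (S : ToeplitzPair c (H →L[ℂ] H)),
      S.IsCovariant ∧ Function.Injective S.p0 := by
  have : IsClosed (c.katsuraSubalgebra : Set A) := c.isClosed_katsura
  obtain ⟨K, _, _, _, σ, hσ, hdet⟩ := c.katsuraSubalgebra.exists_faithful_rep_detecting
    fun b hb a => c.mul_mem_katsura hb a
  obtain ⟨F, _, _, _, T, e, he, hTe, hTs⟩ := c.exists_fock σ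
  have hT := injective_of_intertwines hσ he hTe
  obtain ⟨Φ, hΦ⟩ := T.exists_compacts_map
  obtain ⟨G, _, _, _, ρ, q, hq⟩ := exists_ultrapower (F := F) (Filter.hyperfilter ℕ)
  let R : (F →L[ℂ] F) →L[ℂ] (G →L[ℂ] G) :=
    (ρ : (F →L[ℂ] F) →ₗ[ℂ] (G →L[ℂ] G)).mkContinuous 1 fun S => by
      rw [one_mul]
      exact NonUnitalStarAlgHom.norm_apply_le ρ S
  have hΨ : ∀ x y, R.comp Φ ⟨c.rankOne x y, c.rankOne_mem_compacts x y⟩ =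
      (T.comp ρ).p1 x * star ((T.comp ρ).p1 y) := fun x y => by
    change ρ (Φ _) = ρ _ * star (ρ _)
    rw [hΦ, map_mul, map_star]
  set E := (T.comp ρ).covariantSubspace (R.comp Φ) with hE
  have : CompleteSpace E :=
    (ToeplitzPair.isClosed_covariantSubspace _ _).completeSpace_coe
  have h0 : ∀ a, ∀ h ∈ E, (T.comp ρ).p0 a h ∈ E := fun a h hh =>
    ToeplitzPair.p0_mem_covariantSubspace hΨ hh a
  have h1 : ∀ x, ∀ h ∈ E, (T.comp ρ).p1 x h ∈ E := fun x h hh =>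
    ToeplitzPair.p1_mem_covariantSubspace hΨ hh x
  have hmem : ∀ h : boundedFamilies ℕ F, (∀ w, ∀ a, (ha : a ∈ c.katsura) →
      ∀ᶠ i in Filter.hyperfilter ℕ, T.p0 a (T.annihilateWord w (h.1 i)) =
        Φ ⟨c.lact a, ha.1⟩ (T.annihilateWord w (h.1 i))) → q h ∈ E := fun h hh =>
    hq.mem_covariantSubspace (fun _ => rfl) hh
  obtain ⟨S, hS0, hS1, hSs⟩ := (T.comp ρ).exists_restrict E h0 h1 fun x h hh =>
    ToeplitzPair.star_p1_mem_covariantSubspace hh x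
  refine ⟨E, _, _, this, S, ToeplitzPair.isCovariant_of_restrict hS0 hS1 hSs hΨ
    fun a ha h hh => ToeplitzPair.p0_eq_on_covariantSubspace hh ha,
    (injective_iff_map_eq_zero S.p0).2 fun z hz => ?_⟩
  set Z := (T.comp ρ).kernelOn E h0
  have : IsClosed (Z : Set A) := ToeplitzPair.isClosed_kernelOn _ _
  have hzZ : z ∈ Z := fun h hh => by
    rw [← show _ = (T.comp ρ).p0 z h from hS0 z ⟨h, hh⟩, hz, zero_apply, ZeroMemClass.coe_zero]
  have hlim : ∀ a ∈ Z, ∀ h : boundedFamilies ℕ F, q h ∈ E →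
      Tendsto (fun i => ‖T.p0 a (h.1 i)‖) (Filter.hyperfilter ℕ) (𝓝 0) := fun a ha h hh => by
    have h2 : ρ (T.p0 a) (q h) = 0 := ha _ hh
    rw [hq.map_apply] at h2
    have h3 := hq.tendsto_norm (boundedFamilies.map (T.p0 a) h)
    rwa [h2, norm_zero] at h3
  have hΦe : ∀ k h, Φ k (e h) = 0 := fun k h => by
    have : (ContinuousLinearMap.apply ℂ F (e h)).comp Φ = 0 := c.compacts_ext fun x y => by
      change Φ _ (e h) = 0
      rw [hΦ, mul_apply_eq_comp, hTs, map_zero]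
    exact congrArg (· k) this
  have hZ : (Z : Set A) ⊆ c.katsura := fun a ha => by
    by_contra haJ
    obtain ⟨k, hk, hak⟩ := hdet a haJ
    have h2 := hlim a ha ⟨fun _ => e k, ‖e k‖, fun _ => le_rfl⟩ <|
      hmem _ fun w b hb => .of_forall fun _ => by
        cases w with
        | nil => exact (hTe b k).trans (by rw [hk b hb, map_zero]; exact (hΦe _ k).symm)
        | cons x w =>
          rw [ToeplitzPair.annihilateWord, mul_apply_eq_comp, hTs, map_zero, map_zero, map_zero]
    have h3 : ‖T.p0 a (e k)‖ = 0 := tendsto_nhds_unique tendsto_const_nhds h2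
    rw [norm_eq_zero, hTe] at h3
    exact hak ((e.isometryOfInner he).injective (h3.trans (map_zero e).symm))
  by_contra hz0
  have hex : ∀ n, ∃ h ∈ T.tail n, ‖h‖ < 1 ∧ ‖z‖ / 2 < ‖T.p0 z h‖ := fun n =>
    Z.exists_lt_norm_apply T.p0 (T.tail n) (fun a h hh => T.p0_mem_tail a hh)
      (ToeplitzPair.eq_zero_of_p0_tail_eq_zero hT hZ (fun a ha x y =>
        ToeplitzPair.inner_lact_mem_kernelOn _ h0 h1 ha x y) n) hzZ
      (half_lt_self (norm_pos_iff.2 hz0))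
  choose h hht hh1 hh2 using hex
  have h2 := hlim z hzZ ⟨h, 1, fun i => (hh1 i).le⟩ <| hmem _ fun w a ha => by
    filter_upwards [Nat.hyperfilter_le_atTop (Filter.eventually_ge_atTop (1 + w.length))] with n hn
    exact ToeplitzPair.p0_eq_on_tail hΦ
      (T.annihilateWord_mem_tail w (T.tail_antitone hn (hht n))) ha
  have h3 := ge_of_tendsto' h2 fun i => (hh2 i).le
  linarith [norm_pos_iff.2 hz0]

end Correspondence

/-- If the left action of `J_X` on `X` is degenerate, then
there are a Hilbert space `H`, a covariant Toeplitz pair `(π⁰, π¹)` of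
`(A, X)` on `H` with `π⁰` injective, and `x ∈ X` such that `P π¹(x) ≠ π¹(x)`,
where `P` is the strong-operator limit of `(π⁰(b))_{b ∈ N}` along a positive
contractive approximate unit `N` of `J_X`. -/
theorem exists_degenerateWitness_of_not_katsuraNondegenerate
    {A : Type u} {X : Type v} [iA : NonUnitalCStarAlgebra A]
    [iX₁ : NormedAddCommGroup X] [iX₂ : NormedSpace ℂ X] [iX₃ : CompleteSpace X]
    (c : Correspondence A X) (hdeg : ¬ c.KatsuraNondegenerate) :
    ∃ (H : Type (max u v)) (i₁ : NormedAddCommGroup H)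
      (i₂ : @InnerProductSpace ℂ H _ i₁.toSeminormedAddCommGroup) (i₃ : CompleteSpace H),
      @DegenerateWitness A X iA iX₁ iX₂ iX₃ c H i₁ i₂ i₃ := by
  have : IsClosed (c.katsuraSubalgebra : Set A) := c.isClosed_katsura
  obtain ⟨N, hN⟩ := c.katsuraSubalgebra.exists_isPosApproxUnit
  obtain ⟨l, _, hl⟩ := hN.exists_filter
  obtain ⟨E, _, _, _, T, hcov, hinj⟩ := c.exists_covariant_injective
  obtain ⟨H, i₁, i₂, i₃, ρ, q, hq⟩ := exists_ultrapower (F := E) (Ultrafilter.of l)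
  obtain ⟨P, hP, -⟩ := hN.exists_tendsto hl (T.comp ρ).p0
  obtain ⟨x, hx⟩ : ∃ x, x ∉ (Submodule.span ℂ
      {z : X | ∃ a ∈ c.katsura, ∃ x, z = c.lact a x}).topologicalClosure := by
    simpa [Correspondence.KatsuraNondegenerate, Submodule.eq_top_iff'] using hdeg
  obtain ⟨δ, hδ, hball⟩ :=
    Metric.isOpen_iff.1 (Submodule.isClosed_topologicalClosure _).isOpen_compl x hx
  obtain ⟨h, hh⟩ := hN.exists_not_tendsto hl (Ultrafilter.of_le l) hq T.p0 (T.p1 x) hδ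
    fun b hb => by
      rw [T.p0_mul_p1, ← map_sub, T.norm_p1 hinj, ← dist_eq_norm, dist_comm]
      exact not_lt.1 fun hlt => hball hlt
        (Submodule.le_topologicalClosure _ (Submodule.subset_span ⟨b, hN.subset hb, x, rfl⟩))
  refine ⟨H, i₁, i₂, i₃, T.comp ρ, hcov.comp ρ, hq.injective.comp hinj, N, P, x, hN,
    fun h ε hε => ?_, fun hPx => hh ?_⟩
  · obtain ⟨b₀, hb₀, hb⟩ := (hl.tendsto_iff Metric.nhds_basis_ball).1 (hP h) ε hε
    exact ⟨b₀, hb₀, fun b hbN hle => mem_ball_iff_norm.1 (hb b ⟨hbN, hle⟩)⟩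
  · have h1 := hP (ρ (T.p1 x) h)
    rwa [show P (ρ (T.p1 x) h) = ρ (T.p1 x) h from congrArg (· h) hPx] at h1

end
end

section
/- Let E = (E^0, E^1, s, r) be a topological graph with associated graph correspondence X(E) over C_0(E^0) and left action λ: C_0(E^0) → L(X(E)). Then ker λ = C_0(E^0 \ cl(r(E^1))), where cl denotes topological closure; consequently the Katsura ideal of X(E) is J_{X(E)} = C_0(E^0_fin ∩ Int(cl(r(E^1)))). -/
/-!
Common framework: Hilbert C*-modules, C*-correspondences, compact operators,
the Katsura ideal, Toeplitz pairs, covariance, Cuntz-Pimsner algebras,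
completely positive completely contractive maps, and hyperrigidity.
-/

noncomputable section

open Filter Topology Set
open scoped ComplexOrder InnerProductSpace

universe u v w u'

open scoped ZeroAtInfty CompactlySupported

universe t

/-- A topological graph `E = (E⁰, E¹, s, r)`: `E⁰, E¹` are (locally compact
Hausdorff) topological spaces, the source map `s` is a local homeomorphism and
the range map `r` is continuous. -/
structure TopGraph (E₀ E₁ : Type t) [TopologicalSpace E₀] [TopologicalSpace E₁] where
  s : E₁ → E₀
  r : E₁ → E₀
  isLocalHomeomorph_s : IsLocalHomeomorph s
  continuous_r : Continuous r

/-- `(c, j)` realizes the C*-correspondence `X` over `C₀(E⁰, ℂ)` as the graph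
correspondence `X(E)` of the topological graph `E`: `j` embeds `C_c(E¹, ℂ)` as
a dense subspace of `X`, carrying the `C₀(E⁰)`-valued inner product
`⟨f,h⟩(x) = ∑_{s(e)=x} conj (f e) * h e`, the right action
`(f·φ)(e) = f(e)φ(s(e))` and the left action `(λ(φ)f)(e) = φ(r(e))f(e)`. -/
structure IsGraphCorrespondence {E₀ E₁ : Type t} [TopologicalSpace E₀]
    [TopologicalSpace E₁] (g : TopGraph E₀ E₁) {X : Type v}
    [NormedAddCommGroup X] [NormedSpace ℂ X] [CompleteSpace X]
    (c : Correspondence C₀(E₀, ℂ) X) (j : C_c(E₁, ℂ) → X) : Prop where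
  j_add : ∀ f h, j (f + h) = j f + j h
  j_csmul : ∀ (z : ℂ) f, j (z • f) = z • j f
  dense_range : closure (Set.range j) = Set.univ
  inner_apply : ∀ (f h : C_c(E₁, ℂ)) (x : E₀),
    c.toHilbertModule.inner (j f) (j h) x
      = ∑' e : {e : E₁ // g.s e = x}, starRingEnd ℂ (f e.1) * h e.1
  smulR_apply : ∀ (f : C_c(E₁, ℂ)) (φ : C₀(E₀, ℂ)), ∃ F : C_c(E₁, ℂ),
    (∀ e, F e = f e * φ (g.s e)) ∧ c.toHilbertModule.smulR (j f) φ = j F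
  lact_apply : ∀ (f : C_c(E₁, ℂ)) (φ : C₀(E₀, ℂ)), ∃ F : C_c(E₁, ℂ),
    (∀ e, F e = φ (g.r e) * f e) ∧ c.lact φ (j f) = j F

/-- The open subset `E⁰_fin ⊆ E⁰` determined by the closed ideal
`λ⁻¹(K(X(E))) = C₀(E⁰_fin)` of `C₀(E⁰)` (under the correspondence between
closed ideals of `C₀(E⁰)` and open subsets of `E⁰`, the open set is the set of
points where some element of the ideal does not vanish). -/
def E0fin {E₀ : Type t} [TopologicalSpace E₀] {X : Type v}
    [NormedAddCommGroup X] [NormedSpace ℂ X] [CompleteSpace X]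
    (c : Correspondence C₀(E₀, ℂ) X) : Set E₀ :=
  {x | ∃ φ : C₀(E₀, ℂ), c.lact φ ∈ c.toHilbertModule.compacts ∧ φ x ≠ 0}

theorem exists_compactlySupported_apply_eq_one {Y : Type*} [TopologicalSpace Y]
    [LocallyCompactSpace Y] [T2Space Y] {U : Set Y} (hU : IsOpen U) {x : Y} (hx : x ∈ U) :
    ∃ f : C_c(Y, ℂ), f x = 1 ∧ ∀ y ∉ U, f y = 0 := by
  obtain ⟨f, hf1, hf0, hfc, -⟩ := exists_continuous_one_zero_of_isCompact
    (isCompact_singleton (x := x)) hU.isClosed_compl (by simpa using hx)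
  refine ⟨⟨⟨fun y => (f y : ℂ), by fun_prop⟩, hfc.comp_left (g := Complex.ofReal) (by simp)⟩,
    ?_, fun y hy => ?_⟩
  · change ((f x : ℝ) : ℂ) = 1
    simp [hf1 (mem_singleton x)]
  · change ((f y : ℝ) : ℂ) = 0
    simp [hf0 hy]

namespace ZeroAtInftyContinuousMap

variable {Y : Type*} [TopologicalSpace Y]

theorem norm_apply_le (f : C₀(Y, ℂ)) (x : Y) : ‖f x‖ ≤ ‖f‖ :=
  f.toBCF.norm_coe_le_norm x

theorem norm_le_of_forall_le {f : C₀(Y, ℂ)} {C : ℝ} (hC : 0 ≤ C) (h : ∀ x, ‖f x‖ ≤ C) :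
    ‖f‖ ≤ C :=
  (BoundedContinuousFunction.norm_le hC).2 h

theorem isCompact_setOf_le_norm (f : C₀(Y, ℂ)) {ε : ℝ} (hε : 0 < ε) :
    IsCompact {x | ε ≤ ‖f x‖} := by
  have h : ∀ᶠ x in cocompact Y, ‖f x‖ < ε := by
    have := (zero_at_infty f).norm
    rw [norm_zero] at this
    exact this.eventually_lt_const hε
  obtain ⟨K, hK, hKs⟩ := mem_cocompact.1 h
  refine hK.of_isClosed_subset (isClosed_le continuous_const (map_continuous f).norm) ?_
  intro x hx
  by_contra hxK
  have : ‖f x‖ < ε := hKs hxK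
  exact not_lt.2 hx this

/-- The quotient of `f ∈ C₀(Y)` by a continuous function that is bounded below. -/
def divMax (f : C₀(Y, ℂ)) (k : Y → ℝ) (hk : Continuous k) (m : ℝ) (hm : 0 < m) : C₀(Y, ℂ) where
  toFun x := f x / ((max (k x) m : ℝ) : ℂ)
  continuous_toFun := by
    refine (map_continuous f).div (by fun_prop) fun x => ?_
    exact_mod_cast (lt_max_of_lt_right hm).ne'
  zero_at_infty' := by
    have h : Tendsto (fun x => ‖f x‖ / m) (cocompact Y) (𝓝 0) := by
      simpa using (zero_at_infty f).norm.div_const m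
    refine squeeze_zero_norm (fun x => ?_) h
    rw [norm_div, Complex.norm_real, Real.norm_of_nonneg (hm.le.trans (le_max_right _ _))]
    exact div_le_div_of_nonneg_left (norm_nonneg _) hm (le_max_right _ _)

theorem divMax_apply (f : C₀(Y, ℂ)) (k : Y → ℝ) (hk : Continuous k) (m : ℝ) (hm : 0 < m)
    (x : Y) : f.divMax k hk m hm x = f x / ((max (k x) m : ℝ) : ℂ) := rfl

/-- An element of `C₀(Y)` that vanishes wherever all elements of a closed ideal vanish belongs
to that ideal. -/
theorem mem_of_isClosed_of_forall_apply_eq_zero (I : Submodule ℂ C₀(Y, ℂ))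
    (hI : IsClosed (I : Set C₀(Y, ℂ))) (hmul : ∀ a, ∀ b ∈ I, a * b ∈ I) {f : C₀(Y, ℂ)}
    (hf : ∀ x, (∀ a ∈ I, a x = 0) → f x = 0) : f ∈ I := by
  have hfc : f ∈ closure (I : Set C₀(Y, ℂ)) := by
    refine Metric.mem_closure_iff.2 fun ε hε => ?_
    obtain ⟨h, hhI, ⟨m, hm, hmle⟩, hre, him⟩ : ∃ h ∈ I,
        (∃ m > 0, ∀ x ∈ {x | ε / 2 ≤ ‖f x‖}, m ≤ (h x).re) ∧
        (∀ x, 0 ≤ (h x).re) ∧ ∀ x, (h x).im = 0 := by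
      refine (f.isCompact_setOf_le_norm (half_pos hε)).induction_on
        (p := fun S => ∃ h ∈ I, (∃ m > 0, ∀ x ∈ S, m ≤ (h x).re) ∧
          (∀ x, 0 ≤ (h x).re) ∧ ∀ x, (h x).im = 0) ?_ ?_ ?_ ?_
      · exact ⟨0, I.zero_mem, ⟨1, one_pos, by simp⟩, by simp, by simp⟩
      · rintro s t hst ⟨h, hI, ⟨m, hm, hmt⟩, h'⟩
        exact ⟨h, hI, ⟨m, hm, fun x hx => hmt x (hst hx)⟩, h'⟩
      · rintro s t ⟨h, hI, ⟨m, hm, hms⟩, hre, him⟩ ⟨k, kI, ⟨n, hn, hnt⟩, kre, kim⟩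
        refine ⟨h + k, I.add_mem hI kI, ⟨min m n, lt_min hm hn, ?_⟩, fun x => ?_, fun x => ?_⟩
        · rintro x (hx | hx)
          · have := hms x hx
            have := kre x
            have := min_le_left m n
            simp only [add_apply, Complex.add_re]
            linarith
          · have := hnt x hx
            have := hre x
            have := min_le_right m n
            simp only [add_apply, Complex.add_re]
            linarith
        · simpa using add_nonneg (hre x) (kre x)
        · simp [him x, kim x]
      · intro x hx
        obtain ⟨a, haI, hax⟩ : ∃ a ∈ I, a x ≠ 0 := by
          by_contra! hcon
          have : ε / 2 ≤ ‖f x‖ := hx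
          rw [hf x hcon, norm_zero] at this
          linarith
        have hval : ∀ y, (star a * a) y = ((‖a y‖ ^ 2 : ℝ) : ℂ) := fun y => by
          rw [mul_apply, star_apply, Complex.star_def, Complex.conj_mul']
          push_cast
          rfl
        have hpos : 0 < ‖a x‖ ^ 2 := by positivity
        refine ⟨{y | ‖a x‖ ^ 2 / 2 < ‖a y‖ ^ 2}, mem_nhdsWithin_of_mem_nhds ?_,
          star a * a, hmul _ _ haI, ⟨‖a x‖ ^ 2 / 2, half_pos hpos, fun y hy => ?_⟩,
          fun y => ?_, fun y => ?_⟩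
        · exact (isOpen_lt continuous_const ((map_continuous a).norm.pow 2)).mem_nhds
            (half_lt_self hpos)
        · rw [hval, Complex.ofReal_re]
          exact le_of_lt hy
        · rw [hval, Complex.ofReal_re]
          positivity
        · rw [hval, Complex.ofReal_im]
    have hcont : Continuous fun x => (h x).re := Complex.continuous_re.comp (map_continuous h)
    refine ⟨f.divMax _ hcont m hm * h, hmul _ _ hhI, ?_⟩
    rw [dist_eq_norm]
    refine lt_of_le_of_lt (norm_le_of_forall_le (half_pos hε).le fun x => ?_) (half_lt_self hε)
    have hh : h x = (((h x).re : ℝ) : ℂ) := Complex.ext (by simp) (by simp [him x])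
    have hM : 0 < max (h x).re m := lt_max_of_lt_right hm
    have hval : (f - f.divMax _ hcont m hm * h) x
        = f x * ((1 - (h x).re / max (h x).re m : ℝ) : ℂ) := by
      rw [sub_apply, mul_apply, divMax_apply]
      nth_rewrite 2 [hh]
      push_cast
      ring
    have h1 : (h x).re / max (h x).re m ≤ 1 := (div_le_one hM).2 (le_max_left _ _)
    have h0 : 0 ≤ (h x).re / max (h x).re m := div_nonneg (hre x) hM.le
    rw [hval, norm_mul, Complex.norm_real, Real.norm_of_nonneg (by linarith)]
    by_cases hx : ε / 2 ≤ ‖f x‖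
    · rw [max_eq_left (hmle x hx), div_self (hm.trans_le (hmle x hx)).ne']
      simpa using (half_pos hε).le
    · have := norm_nonneg (f x)
      nlinarith
  rwa [hI.closure_eq] at hfc

end ZeroAtInftyContinuousMap

/-- A compactly supported function has finite support on each fibre of a local homeomorphism. -/
theorem IsLocalHomeomorph.finite_support_fiber {Y Z : Type*} [TopologicalSpace Y]
    [TopologicalSpace Z] [T1Space Z] {s : Y → Z} (hs : IsLocalHomeomorph s) (f : C_c(Y, ℂ))
    (z : Z) : (s ⁻¹' {z} ∩ Function.support f).Finite := by
  refine Set.Finite.subset (s := s ⁻¹' {z} ∩ tsupport f) ?_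
    (inter_subset_inter_right _ (subset_tsupport _))
  refine (f.hasCompactSupport.isCompact.inter_left
    (isClosed_singleton.preimage hs.continuous)).finite ?_
  refine (hs.isLocalHomeomorphOn.mono (subset_univ _)).isDiscrete_of_image ?_
  refine Set.Subsingleton.isDiscrete ?_
  exact subsingleton_singleton.anti (image_subset_iff.2 inter_subset_left)

theorem IsLocalHomeomorph.summable_fiber_norm_sq {Y Z : Type*} [TopologicalSpace Y]
    [TopologicalSpace Z] [T1Space Z] {s : Y → Z} (hs : IsLocalHomeomorph s) (f : C_c(Y, ℂ))
    (z : Z) : Summable fun e : {e : Y // s e = z} => ‖f e.1‖ ^ 2 := by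
  refine summable_of_hasFiniteSupport ?_
  refine ((hs.finite_support_fiber f z).preimage Subtype.val_injective.injOn).subset ?_
  intro e he
  refine ⟨e.2, ?_⟩
  simpa using he

theorem Correspondence.lact_comp_mem_compacts {A : Type*} {X : Type*} [NonUnitalCStarAlgebra A]
    [NormedAddCommGroup X] [NormedSpace ℂ X] [CompleteSpace X] (c : Correspondence A X) (a : A)
    {T : X →L[ℂ] X} (hT : T ∈ c.toHilbertModule.compacts) :
    (c.lact a).comp T ∈ c.toHilbertModule.compacts := by
  let L : (X →L[ℂ] X) →L[ℂ] (X →L[ℂ] X) := ContinuousLinearMap.compL ℂ X X X (c.lact a)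
  have hle : Submodule.span ℂ (Set.range fun p : X × X => c.toHilbertModule.rankOne p.1 p.2)
      ≤ (c.toHilbertModule.compacts).comap L.toLinearMap := by
    rw [Submodule.span_le]
    rintro _ ⟨p, rfl⟩
    have : L (c.toHilbertModule.rankOne p.1 p.2)
        = c.toHilbertModule.rankOne (c.lact a p.1) p.2 := by
      ext z
      exact c.lact_smulR _ _ _
    change L (c.toHilbertModule.rankOne p.1 p.2) ∈ c.toHilbertModule.compacts
    rw [this]
    exact c.toHilbertModule.rankOne_mem_compacts _ _
  have hcl : IsClosed ((c.toHilbertModule.compacts : Submodule ℂ _) : Set (X →L[ℂ] X)) :=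
    Submodule.isClosed_topologicalClosure _
  exact Submodule.topologicalClosure_minimal _ hle (hcl.preimage L.continuous) hT

namespace IsGraphCorrespondence

variable {E₀ E₁ : Type t} [TopologicalSpace E₀] [TopologicalSpace E₁]
  {g : TopGraph E₀ E₁} {X : Type v} [NormedAddCommGroup X] [NormedSpace ℂ X]
  [CompleteSpace X] {c : Correspondence C₀(E₀, ℂ) X} {j : C_c(E₁, ℂ) → X}

theorem inner_self_apply (hgc : IsGraphCorrespondence g c j) (f : C_c(E₁, ℂ)) (x : E₀) :
    c.toHilbertModule.inner (j f) (j f) x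
      = ((∑' e : {e : E₁ // g.s e = x}, ‖f e.1‖ ^ 2 : ℝ) : ℂ) := by
  rw [hgc.inner_apply, Complex.ofReal_tsum]
  refine tsum_congr fun e => ?_
  rw [Complex.conj_mul']
  push_cast
  rfl

theorem map_zero (hgc : IsGraphCorrespondence g c j) : j 0 = 0 := by
  simpa using hgc.j_add 0 0

theorem eq_zero_of_map_eq_zero [T1Space E₀] (hgc : IsGraphCorrespondence g c j)
    {f : C_c(E₁, ℂ)} (hf : j f = 0) (e : E₁) : f e = 0 := by
  have h := hgc.inner_self_apply f (g.s e)
  have h0 : c.toHilbertModule.inner (j f) (j f) = 0 := by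
    rw [← norm_eq_zero, ← c.norm_sq_eq_norm_inner_self, hf, norm_zero, zero_pow two_ne_zero]
  rw [h0, ZeroAtInftyContinuousMap.zero_apply, eq_comm, Complex.ofReal_eq_zero] at h
  have hs := g.isLocalHomeomorph_s.summable_fiber_norm_sq f (g.s e)
  have := congrFun ((hasSum_zero_iff_of_nonneg fun _ => sq_nonneg _).1 (hs.hasSum_iff.2 h))
    ⟨e, rfl⟩
  simpa using this

theorem norm_lact_le [T1Space E₀] (hgc : IsGraphCorrespondence g c j) (φ : C₀(E₀, ℂ)) :
    ‖c.lact φ‖ ≤ ‖φ‖ := by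
  refine ContinuousLinearMap.opNorm_le_bound _ (norm_nonneg _) fun x => ?_
  have hcl : IsClosed {x : X | ‖c.lact φ x‖ ≤ ‖φ‖ * ‖x‖} :=
    isClosed_le (by fun_prop) (by fun_prop)
  refine closure_minimal ?_ hcl (hgc.dense_range ▸ mem_univ x)
  rintro _ ⟨f, rfl⟩
  obtain ⟨F, hF, hjF⟩ := hgc.lact_apply f φ
  change ‖c.lact φ (j f)‖ ≤ ‖φ‖ * ‖j f‖
  rw [hjF]
  refine le_of_sq_le_sq ?_ (by positivity)
  rw [mul_pow, c.norm_sq_eq_norm_inner_self, c.norm_sq_eq_norm_inner_self]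
  refine ZeroAtInftyContinuousMap.norm_le_of_forall_le (by positivity) fun y => ?_
  refine le_trans ?_ (mul_le_mul_of_nonneg_left
    (ZeroAtInftyContinuousMap.norm_apply_le _ y) (by positivity))
  rw [hgc.inner_self_apply, hgc.inner_self_apply, Complex.norm_real, Complex.norm_real,
    Real.norm_of_nonneg (tsum_nonneg fun _ => sq_nonneg _),
    Real.norm_of_nonneg (tsum_nonneg fun _ => sq_nonneg _), ← tsum_mul_left]
  refine (g.isLocalHomeomorph_s.summable_fiber_norm_sq F y).tsum_le_tsum (fun e => ?_)
    ((g.isLocalHomeomorph_s.summable_fiber_norm_sq f y).mul_left _)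
  rw [hF, norm_mul, mul_pow]
  gcongr
  exact φ.norm_apply_le _

theorem lact_eq_zero_iff [T2Space E₀] [LocallyCompactSpace E₁] [T2Space E₁]
    (hgc : IsGraphCorrespondence g c j) (φ : C₀(E₀, ℂ)) :
    c.lact φ = 0 ↔ ∀ x ∈ closure (Set.range g.r), φ x = 0 := by
  constructor
  · intro h
    have hcl : IsClosed {x | φ x = 0} := isClosed_eq (map_continuous φ) continuous_const
    refine fun x hx => closure_minimal ?_ hcl hx
    rintro _ ⟨e, rfl⟩
    obtain ⟨f, hf, -⟩ := exists_compactlySupported_apply_eq_one isOpen_univ (mem_univ e)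
    obtain ⟨F, hF, hjF⟩ := hgc.lact_apply f φ
    rw [h, zero_apply] at hjF
    have := hgc.eq_zero_of_map_eq_zero hjF.symm e
    rwa [hF, hf, mul_one] at this
  · intro h
    ext x
    have hcl : IsClosed {x : X | c.lact φ x = 0} :=
      isClosed_eq (c.lact φ).continuous continuous_const
    refine closure_minimal ?_ hcl (hgc.dense_range ▸ mem_univ x)
    rintro _ ⟨f, rfl⟩
    obtain ⟨F, hF, hjF⟩ := hgc.lact_apply f φ
    have hF0 : F = 0 := by
      ext e
      simp [hF, h _ (subset_closure (mem_range_self e))]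
    change c.lact φ (j f) = 0
    rw [hjF, hF0, hgc.map_zero]

theorem lact_mem_compacts_iff [T1Space E₀] (hgc : IsGraphCorrespondence g c j)
    (φ : C₀(E₀, ℂ)) :
    c.lact φ ∈ c.toHilbertModule.compacts ↔ ∀ x ∉ E0fin c, φ x = 0 := by
  refine ⟨fun h x hx => by_contra fun hφ => hx ⟨φ, h, hφ⟩, fun h => ?_⟩
  let L : C₀(E₀, ℂ) →ₗ[ℂ] (X →L[ℂ] X) :=
    { toFun := c.lact, map_add' := c.lact_add, map_smul' := c.lact_csmul }
  have hL : Continuous L :=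
    (L.mkContinuous 1 fun a => (hgc.norm_lact_le a).trans_eq (one_mul _).symm).continuous
  refine ZeroAtInftyContinuousMap.mem_of_isClosed_of_forall_apply_eq_zero
    ((c.toHilbertModule.compacts).comap L)
    ((Submodule.isClosed_topologicalClosure _).preimage hL) (fun a b hb => ?_) fun x hx => ?_
  · change c.lact (a * b) ∈ c.toHilbertModule.compacts
    rw [c.lact_mul]
    exact c.lact_comp_mem_compacts a hb
  · exact h x fun ⟨a, ha, hax⟩ => hax (hx a ha)

end IsGraphCorrespondence

/-- For a topological graph `E`, the kernel of the left action
`λ` on `X(E)` is `C₀(E⁰ \ cl(r(E¹)))` (the functions vanishing on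
`cl(r(E¹))`), and consequently the Katsura ideal is
`J_{X(E)} = C₀(E⁰_fin ∩ Int(cl(r(E¹))))` (the functions in `λ⁻¹(K(X(E)))`
vanishing off `E⁰_fin ∩ Int(cl(r(E¹)))`). -/
theorem ker_lact_eq_and_katsura_eq_of_graph
    {E₀ E₁ : Type t} [TopologicalSpace E₀] [TopologicalSpace E₁]
    [LocallyCompactSpace E₀] [T2Space E₀] [LocallyCompactSpace E₁] [T2Space E₁]
    (g : TopGraph E₀ E₁) {X : Type v} [NormedAddCommGroup X] [NormedSpace ℂ X]
    [CompleteSpace X] (c : Correspondence C₀(E₀, ℂ) X) (j : C_c(E₁, ℂ) → X)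
    (hgc : IsGraphCorrespondence g c j) :
    (∀ φ : C₀(E₀, ℂ), c.lact φ = 0 ↔ ∀ x ∈ closure (Set.range g.r), φ x = 0) ∧
    (∀ φ : C₀(E₀, ℂ), φ ∈ c.katsura ↔
      ∀ x : E₀, x ∉ E0fin c ∩ interior (closure (Set.range g.r)) → φ x = 0) := by
  refine ⟨hgc.lact_eq_zero_iff, fun φ => ?_⟩
  have hker : (∀ b, c.lact b = 0 → φ * b = 0) ↔
      ∀ x ∉ interior (closure (Set.range g.r)), φ x = 0 := by
    constructor
    · intro h x hx
      rw [← mem_compl_iff, ← closure_compl] at hx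
      have hcl : IsClosed {x | φ x = 0} := isClosed_eq (map_continuous φ) continuous_const
      refine closure_minimal (fun y hy => ?_) hcl hx
      obtain ⟨f, hf, hf0⟩ :=
        exists_compactlySupported_apply_eq_one isClosed_closure.isOpen_compl hy
      let b : C₀(E₀, ℂ) := ⟨f.toContinuousMap, f.hasCompactSupport.is_zero_at_infty⟩
      have hb : c.lact b = 0 :=
        (hgc.lact_eq_zero_iff b).2 fun z hz => hf0 z (not_not_intro hz)
      have hφb : φ y * f y = 0 := DFunLike.congr_fun (h b hb) y
      rwa [hf, mul_one] at hφb
    · intro h b hb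
      ext x
      rw [ZeroAtInftyContinuousMap.mul_apply, ZeroAtInftyContinuousMap.zero_apply]
      by_cases hx : x ∈ interior (closure (Set.range g.r))
      · rw [(hgc.lact_eq_zero_iff b).1 hb x (interior_subset hx), mul_zero]
      · rw [h x hx, zero_mul]
  change _ ∧ _ ↔ _
  rw [hker, hgc.lact_mem_compacts_iff]
  constructor
  · rintro ⟨h₁, h₂⟩ x hx
    by_cases hfin : x ∈ E0fin c
    · exact h₂ x fun hint => hx ⟨hfin, hint⟩
    · exact h₁ x hfin
  · exact fun h => ⟨fun x hx => h x fun hx' => hx hx'.1, fun x hx => h x fun hx' => hx hx'.2⟩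

end
end

section
/- Let E = (E^0, E^1, s, r) be a topological graph. Then E^0 \ cl(r(E^1)) ⊆ E^0_fin; consequently, every open set U ⊆ E^0 with U ∩ E^0_fin = ∅ satisfies U ⊆ Int(cl(r(E^1))). -/
/-!
Common framework: Hilbert C*-modules, C*-correspondences, compact operators,
the Katsura ideal, Toeplitz pairs, covariance, Cuntz-Pimsner algebras,
completely positive completely contractive maps, and hyperrigidity.
-/

noncomputable section

open Filter Topology Set
open scoped ComplexOrder InnerProductSpace

universe u v w u'

open scoped ZeroAtInfty CompactlySupported

universe t

/-- An element of `C₀(E⁰)` vanishing on `r(E¹)` acts by zero on the graph correspondence. -/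
theorem IsGraphCorrespondence.lact_eq_zero {E₀ E₁ : Type t} [TopologicalSpace E₀]
    [TopologicalSpace E₁] {g : TopGraph E₀ E₁} {X : Type v}
    [NormedAddCommGroup X] [NormedSpace ℂ X] [CompleteSpace X]
    {c : Correspondence C₀(E₀, ℂ) X} {j : C_c(E₁, ℂ) → X}
    (hgc : IsGraphCorrespondence g c j) {φ : C₀(E₀, ℂ)} (hφ : ∀ e, φ (g.r e) = 0) :
    c.lact φ = 0 := by
  have hj : DenseRange j := dense_iff_closure_eq.mpr hgc.dense_range
  have hj0 : j 0 = 0 := by simpa using hgc.j_csmul 0 0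
  refine DFunLike.coe_injective
    (hj.equalizer (c.lact φ).continuous (0 : X →L[ℂ] X).continuous (funext fun f => ?_))
  obtain ⟨F, hF, hl⟩ := hgc.lact_apply f φ
  have hF0 : F = 0 := by
    ext e
    simp [hF, hφ]
  simp [hl, hF0, hj0]

/-- On a locally compact Hausdorff space, `C₀(E₀, ℂ)` separates points from closed sets. -/
theorem exists_zeroAtInfty_ne_zero_of_notMem_isClosed {E₀ : Type t} [TopologicalSpace E₀]
    [LocallyCompactSpace E₀] [T2Space E₀] {s : Set E₀} (hs : IsClosed s) {x : E₀} (hx : x ∉ s) :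
    ∃ φ : C₀(E₀, ℂ), φ x ≠ 0 ∧ ∀ y ∈ s, φ y = 0 := by
  obtain ⟨f, hf1, hf0, hfc, -⟩ := exists_continuous_one_zero_of_isCompact
    (isCompact_singleton (x := x)) hs (disjoint_singleton_left.mpr hx)
  have hsupp : HasCompactSupport fun y => (f y : ℂ) := hfc.comp_left Complex.ofReal_zero
  refine ⟨⟨⟨fun y => (f y : ℂ), by fun_prop⟩, hsupp.is_zero_at_infty⟩, ?_, fun y hy => ?_⟩
  · change (f x : ℂ) ≠ 0
    simp [hf1 (mem_singleton x)]
  · change (f y : ℂ) = 0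
    simp [hf0 hy]

/-- For a topological graph `E`, one has
`E⁰ \ cl(r(E¹)) ⊆ E⁰_fin`; consequently every open `U ⊆ E⁰` with
`U ∩ E⁰_fin = ∅` satisfies `U ⊆ Int(cl(r(E¹)))`. -/
theorem compl_closure_range_subset_E0fin
    {E₀ E₁ : Type t} [TopologicalSpace E₀] [TopologicalSpace E₁]
    [LocallyCompactSpace E₀] [T2Space E₀] [LocallyCompactSpace E₁] [T2Space E₁]
    (g : TopGraph E₀ E₁) {X : Type v} [NormedAddCommGroup X] [NormedSpace ℂ X]
    [CompleteSpace X] (c : Correspondence C₀(E₀, ℂ) X) (j : C_c(E₁, ℂ) → X)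
    (hgc : IsGraphCorrespondence g c j) :
    (closure (Set.range g.r))ᶜ ⊆ E0fin c ∧
    ∀ U : Set E₀, IsOpen U → U ∩ E0fin c = ∅ →
      U ⊆ interior (closure (Set.range g.r)) := by
  have hsub : (closure (Set.range g.r))ᶜ ⊆ E0fin c := by
    intro x hx
    obtain ⟨φ, hφx, hφ⟩ := exists_zeroAtInfty_ne_zero_of_notMem_isClosed isClosed_closure hx
    refine ⟨φ, ?_, hφx⟩
    rw [hgc.lact_eq_zero fun e => hφ _ (subset_closure (mem_range_self e))]
    exact zero_mem _
  refine ⟨hsub, fun U hU hUfin => interior_maximal (fun x hxU => ?_) hU⟩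
  by_contra hx
  exact eq_empty_iff_forall_notMem.mp hUfin x ⟨hxU, hsub hx⟩

end
end
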